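/- arXiv:1601.02320 — 3 statements merged into one kernel-verified Lean document; each statement's English description precedes it below -/
import Mathlib

section
/- (1) If m is even, then n_{−1,1} = n_{−1,−1} = ((p−1)/4)·(p^{m−1} − (−1)^{((p−1)/2)·(m/2)} p^{(m−2)/2}). (2) If m is odd, then n_{−1,1} = ((p−1)/4)·(p^{m−1} − (−1)^{((p−1)/2)·((m−1)/2)} p^{(m−1)/2}) and n_{−1,−1} = ((p−1)/4)·(p^{m−1} + (−1)^{((p−1)/2)·((m−1)/2)} p^{(m−1)/2}). -/
/-- `n_{i,j} = #{a ∈ F_r^* : η(a) = i and η̄(Tr(a⁻¹)) = j}` where `η`, `η̄` are the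
quadratic characters of `F_r` and `F_p` (note `η̄(0) = 0`, so membership forces
`Tr(a⁻¹) ≠ 0`). -/
noncomputable def nij (p : ℕ) [Fact p.Prime] (F : Type) [Field F] [Fintype F]
    [DecidableEq F] [Algebra (ZMod p) F] (i j : ℤ) : ℕ :=
  Set.ncard {a : F | a ≠ 0 ∧ quadraticChar F a = i ∧
    quadraticChar (ZMod p) (Algebra.trace (ZMod p) F a⁻¹) = j}

set_option linter.unusedSectionVars false
section aux
open Finset
variable (p : ℕ) [Fact p.Prime] (F : Type) [Field F] [Fintype F] [DecidableEq F] [Algebra (ZMod p) F]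

lemma tr_surj : Function.Surjective (Algebra.trace (ZMod p) F) :=
  LinearMap.surjective (Algebra.trace_ne_zero (ZMod p) F)

lemma fiber_card (k : ℕ) (hcard : Fintype.card F = p ^ (k+1)) (c : ZMod p) :
    #{a : F | Algebra.trace (ZMod p) F a = c} = p ^ k := by
  have h1 : ∀ d : ZMod p, #{a : F | Algebra.trace (ZMod p) F a = d} = #{a : F | Algebra.trace (ZMod p) F a = c} := by
    intro d
    obtain ⟨b, hb⟩ := tr_surj p F (c - d)
    refine Finset.card_bij' (fun a _ => a + b) (fun a _ => a - b) ?_ ?_ ?_ ?_ <;> simp [hb] <;> grind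
  have h2 : Fintype.card F = ∑ d : ZMod p, #{a : F | Algebra.trace (ZMod p) F a = d} := by
    rw [← Finset.card_univ]
    exact Finset.card_eq_sum_card_fiberwise (fun _ _ => by simp)
  simp only [h1, sum_const, card_univ, ZMod.card, smul_eq_mul, hcard, pow_succ'] at h2
  exact (Nat.eq_of_mul_eq_mul_left (Fact.out : p.Prime).pos h2).symm

lemma finrank_eq (k : ℕ) (hcard : Fintype.card F = p ^ k) : Module.finrank (ZMod p) F = k := by
  have := Module.card_eq_pow_finrank (K := ZMod p) (V := F)
  rw [hcard, ZMod.card] at this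
  exact (Nat.pow_right_injective (Fact.out : p.Prime).two_le this).symm

open Polynomial in
lemma fiber_prod (hp2 : p ≠ 2) (k : ℕ) (hcard : Fintype.card F = p ^ (k+1)) :
    ∏ a : F with Algebra.trace (ZMod p) F a = 1, a = 1 := by
  have hp := (Fact.out : p.Prime)
  set T : Finset F := {a : F | Algebra.trace (ZMod p) F a = 1} with hT
  have hTc : #T = p ^ k := fiber_card p F k hcard 1
  let R : F[X] := ∑ i ∈ Finset.range k, X ^ (p ^ i) - 1
  have hR : R.degree < (p ^ k : ℕ) := by
    refine lt_of_le_of_lt (degree_sub_le _ _) (max_lt ?_ ?_)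
    · refine lt_of_le_of_lt (degree_sum_le _ _) ?_
      rw [Finset.sup_lt_iff (by exact WithBot.bot_lt_coe _)]
      intro i hi
      rw [degree_X_pow]
      exact_mod_cast Nat.pow_lt_pow_right hp.one_lt (by simpa using hi)
    · rw [degree_one]
      exact_mod_cast Nat.pos_of_ne_zero (pow_ne_zero _ hp.ne_zero)
  let Q : F[X] := X ^ (p ^ k) + R
  have hQm : Q.Monic := monic_X_pow_add hR
  have hQd : Q.degree = (p ^ k : ℕ) := by
    rw [degree_add_eq_left_of_degree_lt (by rwa [degree_X_pow]), degree_X_pow]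
  let N : F[X] := ∏ a ∈ T, (X - C a)
  have hNm : N.Monic := monic_prod_of_monic _ _ (fun a _ => monic_X_sub_C a)
  have hNd : N.degree = (p ^ k : ℕ) := by
    simp [N, degree_prod, hTc]
  have hev : ∀ a : F, Q.eval a = algebraMap (ZMod p) F (Algebra.trace (ZMod p) F a) - 1 := by
    intro a
    rw [FiniteField.algebraMap_trace_eq_sum_pow, finrank_eq p F _ hcard, Finset.sum_range_succ]
    simp [Q, R, eval_finsetSum]
    ring
  have hQN : Q = N := by
    refine eq_of_degree_sub_lt_of_eval_finset_eq T ?_ ?_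
    · rw [hTc, ← hQd]
      exact degree_sub_lt_left (hQd.trans hNd.symm) hQm.ne_zero (by rw [hQm.leadingCoeff, hNm.leadingCoeff])
    · intro a ha
      rw [hev]
      have : Algebra.trace (ZMod p) F a = 1 := by simpa [hT] using ha
      rw [this, map_one, sub_self, eval_prod]
      exact (Finset.prod_eq_zero ha (by simp)).symm
  have h0 := hev 0
  have hodd : Odd (p ^ k) := (hp.odd_of_ne_two hp2).pow
  rw [hQN, eval_prod] at h0
  have h6 : ∏ x ∈ T, -x = -∏ x ∈ T, x := by
    rw [Finset.prod_neg, hTc, hodd.neg_one_pow, neg_one_mul]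
  simp [h6] at h0
  exact h0

lemma char_ne (hp2 : p ≠ 2) : ringChar F ≠ 2 := by
  rw [← Algebra.ringChar_eq (ZMod p) F, ZMod.ringChar_zmod_n]; exact hp2

lemma sq_eq_one_iff_of_int {x : ℤ} : x ^ 2 = 1 ↔ x = 1 ∨ x = -1 := by
  have := sq_eq_sq_iff_eq_or_eq_neg (a := x) (b := 1)
  rwa [one_pow] at this

lemma chi_F (hp2 : p ≠ 2) (m : ℕ) (hcard : Fintype.card F = p ^ m) (c : ZMod p) (hc : c ≠ 0) :
    quadraticChar F (algebraMap (ZMod p) F c) = quadraticChar (ZMod p) c ^ m := by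
  have hp := (Fact.out : p.Prime)
  have hF := char_ne p F hp2
  have hc' : algebraMap (ZMod p) F c ≠ 0 := by simpa using hc
  have hZ : ringChar (ZMod p) ≠ 2 := by rwa [ZMod.ringChar_zmod_n]
  have h1 := quadraticChar_eq_pow_of_char_ne_two' hF (algebraMap (ZMod p) F c)
  have h2 := quadraticChar_eq_pow_of_char_ne_two' hZ c
  have hpo := hp.odd_of_ne_two hp2
  have hexp : p ^ m / 2 = p / 2 * ∑ i ∈ Finset.range m, p ^ i := by
    obtain ⟨q, rfl⟩ := hpo
    have h3 := geom_sum_mul_add (2 * q) m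
    have h4 : (2 * q + 1) / 2 = q := by omega
    rw [h4, ← h3]
    have : (∑ i ∈ range m, (2 * q + 1) ^ i) * (2 * q) = 2 * (q * ∑ i ∈ range m, (2 * q + 1) ^ i) := by ring
    omega
  have hN : Odd (∑ i ∈ Finset.range m, p ^ i) ↔ Odd m := by
    rw [Finset.odd_sum_iff_odd_card_odd]
    simp [hpo.pow]
  have h5 : ((quadraticChar F (algebraMap (ZMod p) F c) : ℤ) : F) =
      ((quadraticChar (ZMod p) c ^ (∑ i ∈ Finset.range m, p ^ i) : ℤ) : F) := by
    rw [ZMod.card] at h2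
    rw [h1, hcard, hexp, pow_mul, ← map_pow, ← h2]
    simp
  have h7 : quadraticChar (ZMod p) c ^ (∑ i ∈ Finset.range m, p ^ i) = quadraticChar (ZMod p) c ^ m := by
    rcases quadraticChar_dichotomy hc with h | h
    · simp [h]
    · rw [h]
      by_cases ho : Odd m
      · rw [ho.neg_one_pow, (hN.2 ho).neg_one_pow]
      · rw [(Nat.not_odd_iff_even.1 ho).neg_one_pow, (Nat.not_odd_iff_even.1 (mt hN.1 ho)).neg_one_pow]
  rw [h7] at h5
  have hne : (-1 : F) ≠ 1 := Ring.neg_one_ne_one_of_char_ne_two hF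
  rcases quadraticChar_dichotomy hc' with h | h <;>
    rcases (sq_eq_one_iff_of_int).1 (show (quadraticChar (ZMod p) c ^ m) ^ 2 = 1 by
      rw [← pow_mul, mul_comm, pow_mul, quadraticChar_sq_one hc, one_pow]) with h' | h' <;>
    rw [h, h'] at h5 ⊢ <;> simp at h5
  · exact absurd h5.symm hne
  · exact absurd h5 hne

noncomputable def SS (c : ZMod p) : ℤ := ∑ a : F with Algebra.trace (ZMod p) F a = c, quadraticChar F a

lemma SS_mul (c d : ZMod p) (hc : c ≠ 0) :
    SS p F (c * d) = quadraticChar F (algebraMap (ZMod p) F c) * SS p F d := by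
  have hc' : algebraMap (ZMod p) F c ≠ 0 := by simpa using hc
  unfold SS
  rw [Finset.mul_sum]
  symm
  refine Finset.sum_bij' (fun a _ => algebraMap (ZMod p) F c * a)
    (fun a _ => algebraMap (ZMod p) F c⁻¹ * a) ?_ ?_ ?_ ?_ ?_
  · intro a ha
    simp only [mem_filter, mem_univ, true_and] at ha ⊢
    rw [← Algebra.smul_def, map_smul, ha, smul_eq_mul]
  · intro a ha
    simp only [mem_filter, mem_univ, true_and] at ha ⊢
    rw [← Algebra.smul_def, map_smul, ha, smul_eq_mul, inv_mul_cancel_left₀ hc]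
  · intro a _
    rw [map_inv₀, inv_mul_cancel_left₀ hc']
  · intro a _
    rw [map_inv₀, mul_inv_cancel_left₀ hc']
  · intro a _
    rw [map_mul]

lemma sum_fiber {M : Type*} [CommRing M] (g : F → M) (f : ZMod p → M) :
    ∑ a : F, g a * f (Algebra.trace (ZMod p) F a) =
      ∑ c, (∑ a : F with Algebra.trace (ZMod p) F a = c, g a) * f c := by
  rw [← Finset.sum_fiberwise_of_maps_to (s := univ) (t := univ) (g := Algebra.trace (ZMod p) F) (by simp)]
  refine Finset.sum_congr rfl fun c _ => ?_
  rw [Finset.sum_mul]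
  refine Finset.sum_congr rfl fun a ha => ?_
  simp only [mem_filter, mem_univ, true_and] at ha
  rw [ha]

lemma gauss_F (hp2 : p ≠ 2) (m : ℕ) (hcard : Fintype.card F = p ^ m) (ψ : AddChar (ZMod p) ℂ) (hψ : ψ ≠ 1) :
    (∑ c, (SS p F c : ℂ) * ψ c) ^ 2 = (quadraticChar F (-1) : ℤ) * p ^ m := by
  have hF := char_ne p F hp2
  let ψ' : AddChar F ℂ := ψ.compAddMonoidHom (Algebra.trace (ZMod p) F).toAddMonoidHom
  have hψ' : ψ' ≠ 1 := by
    obtain ⟨b, hb⟩ := AddChar.ne_one_iff.1 hψ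
    obtain ⟨a, rfl⟩ := tr_surj p F b
    exact AddChar.ne_one_iff.2 ⟨a, hb⟩
  have hprim := AddChar.IsPrimitive.of_ne_one hψ'
  let χ : MulChar F ℂ := (quadraticChar F).ringHomComp (Int.castRingHom ℂ)
  have hχ1 : χ ≠ 1 := (MulChar.ringHomComp_ne_one_iff Int.cast_injective).2 (quadraticChar_ne_one hF)
  have hχ2 : χ.IsQuadratic := (quadraticChar_isQuadratic F).comp _
  have h := gaussSum_sq hχ1 hχ2 hprim
  have h2 : gaussSum χ ψ' = ∑ c, (SS p F c : ℂ) * ψ c := by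
    have := sum_fiber p F (fun a => ((quadraticChar F a : ℤ) : ℂ)) ψ
    simp only [SS, Int.cast_sum]
    rw [← this]
    rfl
  rw [← h2, h, hcard]
  simp [χ]

lemma sq_of_sign (x N : ℤ) (e : ℤ) (he : e = 1 ∨ e = -1) (hN : 0 < N) (h : x ^ 2 = e * N) : x ^ 2 = N := by
  rcases he with rfl | rfl
  · simpa using h
  · nlinarith [sq_nonneg x]

lemma sum_chi (hp2 : p ≠ 2) : ∑ c : ZMod p, quadraticChar (ZMod p) c = 0 :=
  quadraticChar_sum_zero (by rwa [ZMod.ringChar_zmod_n])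

lemma SS_odd (hp2 : p ≠ 2) (m : ℕ) (hm : Odd m) (hcard : Fintype.card F = p ^ m) (c : ZMod p) :
    SS p F c = quadraticChar (ZMod p) c * SS p F 1 := by
  have key : ∀ c : ZMod p, c ≠ 0 → quadraticChar F (algebraMap (ZMod p) F c) = quadraticChar (ZMod p) c := by
    intro c hc
    rw [chi_F p F hp2 m hcard c hc]
    rcases quadraticChar_dichotomy hc with h | h <;> simp [h, hm.neg_one_pow]
  by_cases hc : c = 0
  · subst hc
    obtain ⟨d, hd⟩ := quadraticChar_exists_neg_one (F := ZMod p) (by rwa [ZMod.ringChar_zmod_n])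
    have hd0 : d ≠ 0 := by rintro rfl; simp at hd
    have := SS_mul p F d 0 hd0
    rw [key d hd0, hd, mul_zero] at this
    rw [MulChar.map_zero]
    linarith
  · have := SS_mul p F c 1 hc
    rwa [key c hc, mul_one] at this

lemma SS_even (hp2 : p ≠ 2) (m : ℕ) (hm : Even m) (hcard : Fintype.card F = p ^ m) (c : ZMod p) (hc : c ≠ 0) :
    SS p F c = SS p F 1 := by
  have := SS_mul p F c 1 hc
  rw [chi_F p F hp2 m hcard c hc, mul_one] at this
  rw [this]
  rcases quadraticChar_dichotomy hc with h | h <;> simp [h, hm.neg_one_pow]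

lemma SS_sum (hp2 : p ≠ 2) : ∑ c, SS p F c = 0 := by
  unfold SS
  rw [Finset.sum_fiberwise_of_maps_to (by simp)]
  exact quadraticChar_sum_zero (char_ne p F hp2)

lemma quadChar_neg_one_dich (K : Type) [Field K] [Fintype K] [DecidableEq K] :
    quadraticChar K (-1) = 1 ∨ quadraticChar K (-1) = -1 :=
  quadraticChar_dichotomy (neg_ne_zero.2 one_ne_zero)

lemma SS_sq_odd (hp2 : p ≠ 2) (k : ℕ) (hcard : Fintype.card F = p ^ (2 * k + 1)) :
    SS p F 1 ^ 2 = (p ^ k) ^ 2 := by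
  have hp := (Fact.out : p.Prime)
  have hpp : (0 : ℤ) < p := by exact_mod_cast hp.pos
  have hprim := ZMod.isPrimitive_stdAddChar p
  have hψ : (ZMod.stdAddChar : AddChar (ZMod p) ℂ) ≠ 1 := by
    have := hprim (a := 1) one_ne_zero
    rwa [AddChar.mulShift_one] at this
  have h := gauss_F p F hp2 _ hcard _ hψ
  let χ : MulChar (ZMod p) ℂ := (quadraticChar (ZMod p)).ringHomComp (Int.castRingHom ℂ)
  have hχ1 : χ ≠ 1 := (MulChar.ringHomComp_ne_one_iff Int.cast_injective).2
    (quadraticChar_ne_one (by rwa [ZMod.ringChar_zmod_n]))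
  have hχ2 : χ.IsQuadratic := (quadraticChar_isQuadratic (ZMod p)).comp _
  have h2 := gaussSum_sq hχ1 hχ2 hprim
  have h3 : ∑ c, (SS p F c : ℂ) * ZMod.stdAddChar c = SS p F 1 * gaussSum χ ZMod.stdAddChar := by
    rw [gaussSum, Finset.mul_sum]
    refine Finset.sum_congr rfl fun c _ => ?_
    rw [SS_odd p F hp2 _ (by simp) hcard c]
    simp [χ]; ring
  rw [h3, mul_pow, h2, ZMod.card] at h
  have h4 : SS p F 1 ^ 2 * (quadraticChar (ZMod p) (-1) * p) = quadraticChar F (-1) * p ^ (2 * k + 1) := by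
    simp only [χ, MulChar.ringHomComp_apply, eq_intCast] at h
    exact_mod_cast h
  have h5 : SS p F 1 ^ 2 * quadraticChar (ZMod p) (-1) = quadraticChar F (-1) * (p ^ k) ^ 2 := by
    apply mul_right_cancel₀ hpp.ne'
    rw [mul_assoc, h4]; ring
  have hpk : (0 : ℤ) < (p ^ k) ^ 2 := by positivity
  have h6 := sq_nonneg (SS p F 1)
  rcases quadChar_neg_one_dich (ZMod p) with h7 | h7 <;> rcases quadChar_neg_one_dich F with h8 | h8 <;> rw [h7, h8] at h5 <;> linarith

lemma SS_sq_even (hp2 : p ≠ 2) (k : ℕ) (hcard : Fintype.card F = p ^ (2 * k + 2)) :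
    SS p F 1 ^ 2 = (p ^ k) ^ 2 := by
  have hp := (Fact.out : p.Prime)
  have hpp : (0 : ℤ) < p := by exact_mod_cast hp.pos
  have hprim := ZMod.isPrimitive_stdAddChar p
  have hψ : (ZMod.stdAddChar : AddChar (ZMod p) ℂ) ≠ 1 := by
    have := hprim (a := 1) one_ne_zero
    rwa [AddChar.mulShift_one] at this
  have h := gauss_F p F hp2 _ hcard _ hψ
  have hS : ∀ c, SS p F c = SS p F 1 + if c = 0 then SS p F 0 - SS p F 1 else 0 := by
    intro c
    split_ifs with hc
    · subst hc; ring
    · rw [SS_even p F hp2 _ (by simp [parity_simps]) hcard c hc, add_zero]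
  have h0 : p * SS p F 1 + (SS p F 0 - SS p F 1) = 0 := by
    have := SS_sum p F hp2
    rw [Finset.sum_congr rfl (fun c _ => hS c), Finset.sum_add_distrib] at this
    simpa [ZMod.card] using this
  have h3 : ∑ c, (SS p F c : ℂ) * ZMod.stdAddChar c = ((SS p F 0 - SS p F 1 : ℤ) : ℂ) := by
    rw [Finset.sum_congr rfl (fun c _ => by rw [hS c])]
    simp only [Int.cast_add, add_mul, Finset.sum_add_distrib]
    rw [← Finset.mul_sum, AddChar.sum_eq_zero_of_ne_one hψ]
    simp
  rw [h3] at h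
  have h4 : (SS p F 0 - SS p F 1) ^ 2 = quadraticChar F (-1) * p ^ (2 * k + 2) := by exact_mod_cast h
  have h5 := sq_of_sign _ _ _ (quadChar_neg_one_dich F) (by positivity) h4
  have h6 : SS p F 0 - SS p F 1 = - (p * SS p F 1) := by linarith
  rw [h6] at h5
  apply mul_left_cancel₀ (pow_ne_zero 2 hpp.ne')
  linear_combination h5

lemma SS_mod (hp2 : p ≠ 2) (k : ℕ) (hcard : Fintype.card F = p ^ (k + 1)) :
    ∃ z : ℤ, SS p F 1 = p ^ k - 4 * z := by
  have hne : ∀ a : F, Algebra.trace (ZMod p) F a = 1 → a ≠ 0 := by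
    rintro a h rfl; simp at h
  set T : Finset F := {a : F | Algebra.trace (ZMod p) F a = 1} with hT
  have hprod : ∏ a ∈ T, quadraticChar F a = 1 := by
    rw [← map_prod, fiber_prod p F hp2 k hcard, map_one]
  have hd : ∀ a ∈ T, quadraticChar F a = if quadraticChar F a = -1 then -1 else 1 := by
    intro a ha
    rcases quadraticChar_dichotomy (hne a (by simpa [hT] using ha)) with h | h <;> simp [h]
  have h1 : (-1 : ℤ) ^ #{a ∈ T | quadraticChar F a = -1} = 1 := by
    rw [Finset.prod_congr rfl hd, Finset.prod_ite, Finset.prod_const, Finset.prod_const_one, mul_one] at hprod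
    exact hprod
  have hev : Even #{a ∈ T | quadraticChar F a = -1} := by
    by_contra ho
    rw [(Nat.not_even_iff_odd.1 ho).neg_one_pow] at h1
    norm_num at h1
  obtain ⟨z, hz⟩ := hev
  refine ⟨z, ?_⟩
  have hc := fiber_card p F k hcard 1
  rw [← hT] at hc
  have h2 : SS p F 1 = ∑ a ∈ T, (1 - 2 * if quadraticChar F a = -1 then (1 : ℤ) else 0) := by
    unfold SS
    refine Finset.sum_congr rfl fun a ha => ?_
    have h3 := hd a ha
    split_ifs at h3 ⊢ <;> rw [h3] <;> norm_num
  rw [h2, Finset.sum_sub_distrib, ← Finset.mul_sum, Finset.sum_boole, hz]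
  simp [hc]; ring

/-- sign determination -/
lemma sign_det (q : ℕ) (e : ℕ) (x y : ℤ) (hq : Odd q) (k : ℕ) (h : x ^ 2 = (q ^ k) ^ 2) (hy : y = (-1) ^ e * q ^ k)
    (hx : x ≡ y [ZMOD 4]) : x = y := by
  have h2 : x ^ 2 = y ^ 2 := by
    rw [h, hy, mul_pow, ← pow_mul (-1 : ℤ), mul_comm e, pow_mul]; simp
  rcases sq_eq_sq_iff_eq_or_eq_neg.1 h2 with h3 | h3
  · exact h3
  · exfalso
    have : Odd y := by
      rw [hy]; apply Odd.mul
      · exact Odd.pow (by decide)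
      · exact Odd.pow (by exact_mod_cast hq)
    obtain ⟨w, hw⟩ := this
    rw [h3] at hx
    have := hx.dvd
    omega

lemma pstar_mod (q : ℕ) (hq : Odd q) : (-1 : ℤ) ^ ((q - 1) / 2) * q ≡ 1 [ZMOD 4] := by
  obtain ⟨w, rfl⟩ := hq
  have : (2 * w + 1 - 1) / 2 = w := by omega
  rw [this]
  rcases Nat.even_or_odd' w with ⟨v, rfl | rfl⟩
  · rw [(even_two_mul v).neg_one_pow, Int.modEq_iff_dvd]; push_cast; omega
  · rw [(odd_two_mul_add_one v).neg_one_pow, Int.modEq_iff_dvd]; push_cast; omega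

lemma sq_mod (q : ℕ) (hq : Odd q) : (q : ℤ) ^ 2 ≡ 1 [ZMOD 4] := by
  obtain ⟨w, rfl⟩ := hq
  exact (Int.modEq_iff_dvd.2 ⟨w ^ 2 + w, by push_cast; ring⟩ : (1 : ℤ) ≡ _ [ZMOD 4]).symm

lemma SS_val_odd (hp2 : p ≠ 2) (k : ℕ) (hcard : Fintype.card F = p ^ (2 * k + 1)) :
    SS p F 1 = (-1) ^ ((p - 1) / 2 * k) * p ^ k := by
  have hpo := (Fact.out : p.Prime).odd_of_ne_two hp2
  refine sign_det p _ _ _ hpo k (SS_sq_odd p F hp2 k hcard) rfl ?_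
  obtain ⟨z, hz⟩ := SS_mod p F hp2 _ hcard
  have h1 : SS p F 1 ≡ (p : ℤ) ^ (2 * k) [ZMOD 4] := Int.modEq_iff_dvd.2 ⟨z, by rw [hz]; ring⟩
  have h2 := (pstar_mod p hpo).pow k
  have h3 := (sq_mod p hpo).pow k
  rw [mul_pow, ← pow_mul, one_pow] at h2
  rw [← pow_mul, one_pow] at h3
  exact h1.trans (h3.trans h2.symm)

lemma SS_val_even (hp2 : p ≠ 2) (k : ℕ) (hcard : Fintype.card F = p ^ (2 * k + 2)) :
    SS p F 1 = (-1) ^ ((p - 1) / 2 * (k + 1)) * p ^ k := by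
  have hpo := (Fact.out : p.Prime).odd_of_ne_two hp2
  refine sign_det p _ _ _ hpo k (SS_sq_even p F hp2 k hcard) rfl ?_
  obtain ⟨z, hz⟩ := SS_mod p F hp2 _ hcard
  have h1 : SS p F 1 ≡ (p : ℤ) ^ (2 * k + 1) [ZMOD 4] := Int.modEq_iff_dvd.2 ⟨z, by rw [hz]; ring⟩
  have h2 := ((pstar_mod p hpo).pow (k + 1)).mul_right (p : ℤ)
  have h3 := ((sq_mod p hpo).pow k).mul_right (p : ℤ)
  have h4 := (sq_mod p hpo).mul_left ((-1) ^ ((p - 1) / 2 * (k + 1)) * (p : ℤ) ^ k)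
  rw [mul_pow, ← pow_mul, one_pow, one_mul] at h2
  rw [← pow_mul, one_pow, one_mul, ← pow_succ] at h3
  rw [mul_one] at h4
  refine h1.trans (h3.trans (h2.symm.trans (Int.ModEq.trans ?_ h4)))
  rw [show ∀ a b : ℤ, a * b ^ (k + 1) * b = a * b ^ k * b ^ 2 by intros; ring]

lemma nij_formula (k : ℕ) (hcard : Fintype.card F = p ^ (k + 1)) (j : ℤ) (hj : j = 1 ∨ j = -1) :
    4 * (nij p F (-1) j : ℤ) = ∑ c : ZMod p, (if c = 0 then 0 else (p : ℤ) ^ k - SS p F c) *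
      (quadraticChar (ZMod p) c ^ 2 + j * quadraticChar (ZMod p) c) := by
  have h1 : nij p F (-1) j = #{a : F | quadraticChar F a = -1 ∧
      quadraticChar (ZMod p) (Algebra.trace (ZMod p) F a) = j} := by
    unfold nij
    rw [← Set.ncard_coe_finset]
    have hinv : ∀ a : F, quadraticChar F a⁻¹ = quadraticChar F a := by
      intro a
      by_cases ha : a = 0
      · simp [ha]
      · have h := map_mul (quadraticChar F) a a⁻¹
        rw [mul_inv_cancel₀ ha, map_one] at h
        rcases quadraticChar_dichotomy ha with h' | h' <;> rw [h'] at h ⊢ <;> linarith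
    refine Set.ncard_congr (fun a _ => a⁻¹) ?_ ?_ ?_
    · rintro a ⟨_, h1, h2⟩
      exact Finset.mem_coe.2 (Finset.mem_filter.2 ⟨Finset.mem_univ _, (hinv a).trans h1, h2⟩)
    · intro a b _ _ h
      exact inv_injective h
    · intro b hb
      simp only [coe_filter, mem_univ, true_and, Set.mem_ofPred_eq] at hb
      refine ⟨b⁻¹, ⟨?_, ?_, ?_⟩, inv_inv b⟩
      · rw [Ne, inv_eq_zero]
        rintro rfl
        simp at hb
      · rw [hinv, hb.1]
      · rw [inv_inv, hb.2]
  have h2 : ∀ a : F, 4 * (if quadraticChar F a = -1 ∧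
      quadraticChar (ZMod p) (Algebra.trace (ZMod p) F a) = j then (1 : ℤ) else 0) =
      (quadraticChar F a ^ 2 - quadraticChar F a) *
      (quadraticChar (ZMod p) (Algebra.trace (ZMod p) F a) ^ 2 +
        j * quadraticChar (ZMod p) (Algebra.trace (ZMod p) F a)) := by
    intro a
    rcases quadraticChar_isQuadratic F a with h | h | h <;>
    rcases quadraticChar_isQuadratic (ZMod p) (Algebra.trace (ZMod p) F a) with h' | h' | h' <;>
    rcases hj with rfl | rfl <;> rw [h, h'] <;> norm_num
  rw [h1, Finset.natCast_card_filter, Finset.mul_sum, Finset.sum_congr rfl (fun a _ => h2 a)]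
  rw [sum_fiber p F (fun a => quadraticChar F a ^ 2 - quadraticChar F a)
    (fun c => quadraticChar (ZMod p) c ^ 2 + j * quadraticChar (ZMod p) c)]
  refine Finset.sum_congr rfl fun c _ => ?_
  split_ifs with hc
  · simp [hc]
  · congr 1
    rw [Finset.sum_sub_distrib]
    congr 1
    rw [← Nat.cast_pow, ← fiber_card p F k hcard c, Finset.card_eq_sum_ones]
    push_cast
    refine Finset.sum_congr rfl fun a ha => ?_
    apply quadraticChar_sq_one
    rintro rfl
    simp at ha
    exact hc ha.symm

lemma sum_chi_sq : ∑ c : ZMod p, quadraticChar (ZMod p) c ^ 2 = (p : ℤ) - 1 := by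
  have h : ∀ c : ZMod p, quadraticChar (ZMod p) c ^ 2 = 1 - if c = 0 then 1 else 0 := by
    intro c
    split_ifs with hc
    · simp [hc]
    · rw [quadraticChar_sq_one hc, sub_zero]
  rw [Finset.sum_congr rfl (fun c _ => h c)]
  simp [ZMod.card]

lemma nij_odd (hp2 : p ≠ 2) (k : ℕ) (hcard : Fintype.card F = p ^ (2 * k + 1)) (j : ℤ) (hj : j = 1 ∨ j = -1) :
    4 * (nij p F (-1) j : ℤ) = (p - 1) * (p ^ (2 * k) - j * ((-1) ^ ((p - 1) / 2 * k) * p ^ k)) := by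
  rw [nij_formula p F _ hcard j hj, ← SS_val_odd p F hp2 k hcard]
  have h : ∀ c : ZMod p, (if c = 0 then 0 else (p : ℤ) ^ (2 * k) - SS p F c) *
      (quadraticChar (ZMod p) c ^ 2 + j * quadraticChar (ZMod p) c) =
      (p ^ (2 * k) - j * SS p F 1) * quadraticChar (ZMod p) c ^ 2 +
      (p ^ (2 * k) * j - SS p F 1) * quadraticChar (ZMod p) c := by
    intro c
    split_ifs with hc
    · simp [hc]
    · rw [SS_odd p F hp2 _ (by simp) hcard c]
      linear_combination (- SS p F 1 * quadraticChar (ZMod p) c) * quadraticChar_sq_one hc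
  rw [Finset.sum_congr rfl (fun c _ => h c), Finset.sum_add_distrib, ← Finset.mul_sum, ← Finset.mul_sum,
    sum_chi p hp2, sum_chi_sq]
  ring

lemma nij_even (hp2 : p ≠ 2) (k : ℕ) (hcard : Fintype.card F = p ^ (2 * k + 2)) (j : ℤ) (hj : j = 1 ∨ j = -1) :
    4 * (nij p F (-1) j : ℤ) = (p - 1) * (p ^ (2 * k + 1) - (-1) ^ ((p - 1) / 2 * (k + 1)) * p ^ k) := by
  rw [nij_formula p F _ hcard j hj, ← SS_val_even p F hp2 k hcard]
  have h : ∀ c : ZMod p, (if c = 0 then 0 else (p : ℤ) ^ (2 * k + 1) - SS p F c) *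
      (quadraticChar (ZMod p) c ^ 2 + j * quadraticChar (ZMod p) c) =
      (p ^ (2 * k + 1) - SS p F 1) * quadraticChar (ZMod p) c ^ 2 +
      (p ^ (2 * k + 1) - SS p F 1) * j * quadraticChar (ZMod p) c := by
    intro c
    split_ifs with hc
    · simp [hc]
    · rw [SS_even p F hp2 _ (by simp [parity_simps]) hcard c hc]
      ring
  rw [Finset.sum_congr rfl (fun c _ => h c), Finset.sum_add_distrib, ← Finset.mul_sum, ← Finset.mul_sum,
    sum_chi p hp2, sum_chi_sq]
  ring
end aux


/-- STATEMENT 14 (Lemma on `n_{-1,1}` and `n_{-1,-1}`), stated with both sides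
multiplied by 4:
if `m` is even then `n_{-1,1} = n_{-1,-1} = ((p-1)/4)(p^{m-1} - (-1)^{((p-1)/2)(m/2)} p^{(m-2)/2})`;
if `m` is odd then `n_{-1,±1} = ((p-1)/4)(p^{m-1} ∓ (-1)^{((p-1)/2)((m-1)/2)} p^{(m-1)/2})`. -/
theorem stmt_14 (p m : ℕ) [Fact p.Prime] (hp2 : p ≠ 2) (hm : 2 ≤ m)
    (F : Type) [Field F] [Fintype F] [DecidableEq F] [Algebra (ZMod p) F]
    (hcard : Fintype.card F = p ^ m) :
    (Even m →
      4 * (nij p F (-1) 1 : ℤ)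
        = (p - 1) * (p ^ (m - 1) - (-1) ^ ((p - 1) / 2 * (m / 2)) * p ^ ((m - 2) / 2)) ∧
      4 * (nij p F (-1) (-1) : ℤ)
        = (p - 1) * (p ^ (m - 1) - (-1) ^ ((p - 1) / 2 * (m / 2)) * p ^ ((m - 2) / 2))) ∧
    (Odd m →
      4 * (nij p F (-1) 1 : ℤ)
        = (p - 1) * (p ^ (m - 1)
            - (-1) ^ ((p - 1) / 2 * ((m - 1) / 2)) * p ^ ((m - 1) / 2)) ∧
      4 * (nij p F (-1) (-1) : ℤ)
        = (p - 1) * (p ^ (m - 1)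
            + (-1) ^ ((p - 1) / 2 * ((m - 1) / 2)) * p ^ ((m - 1) / 2))) := by
  refine ⟨fun he => ?_, fun ho => ?_⟩
  · obtain ⟨k, rfl⟩ : ∃ k, m = 2 * k + 2 := by
      obtain ⟨l, rfl⟩ := he
      exact ⟨l - 1, by omega⟩
    have e1 : (2 * k + 2) / 2 = k + 1 := by omega
    have e2 : (2 * k + 2 - 2) / 2 = k := by omega
    have e3 : 2 * k + 2 - 1 = 2 * k + 1 := by omega
    rw [e1, e2, e3]
    exact ⟨nij_even p F hp2 k hcard 1 (Or.inl rfl), nij_even p F hp2 k hcard (-1) (Or.inr rfl)⟩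
  · obtain ⟨k, rfl⟩ := ho
    have e1 : (2 * k + 1 - 1) / 2 = k := by omega
    have e3 : 2 * k + 1 - 1 = 2 * k := by omega
    rw [e1, e3, nij_odd p F hp2 k hcard 1 (Or.inl rfl), nij_odd p F hp2 k hcard (-1) (Or.inr rfl)]
    constructor <;> ring
end

section
/- Suppose p ≡ 3 (mod 4) and m ≥ 2 is even. Let a ∈ F_r^* with Tr(a^{−1}) ≠ 0 and let ρ ∈ F_p^*. Then N(ρ) = N_1(ρ), and N(ρ) = (p−1)p^{m−2}/2 if η̄(ρ·Tr(a^{−1})) = 1, while N(ρ) = (p−1)p^{m−2}/2 + η(a)·(−1)^{m/2}·p^{(m−2)/2} if η̄(ρ·Tr(a^{−1})) = −1. -/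
/-- `N(ρ) = #{x ∈ F_r : Tr(x) ∈ Sq and Tr(a x²) = ρ}`. -/
noncomputable def Nsq' (p : ℕ) (F : Type) [Field F] [Algebra (ZMod p) F]
    (a : F) (ρ : ZMod p) : ℕ :=
  Set.ncard {x : F | (IsSquare (Algebra.trace (ZMod p) F x) ∧
    Algebra.trace (ZMod p) F x ≠ 0) ∧ Algebra.trace (ZMod p) F (a * x ^ 2) = ρ}

/-- `N_1(ρ) = #{x ∈ F_r : Tr(x) ∈ Nsq and Tr(a x²) = ρ}`. -/
noncomputable def Nnsq (p : ℕ) (F : Type) [Field F] [Algebra (ZMod p) F]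
    (a : F) (ρ : ZMod p) : ℕ :=
  Set.ncard {x : F | ¬ IsSquare (Algebra.trace (ZMod p) F x) ∧
    Algebra.trace (ZMod p) F (a * x ^ 2) = ρ}

lemma aux_mod4 (p : ℕ) (hp4 : p % 4 = 3) (n : ℕ) : p ^ n % 4 = if Even n then 1 else 3 := by
  induction n with
  | zero => simp
  | succ k ih =>
    rw [pow_succ, Nat.mul_mod, ih, hp4]
    by_cases h : Even k <;> simp [h, Nat.even_add_one]

open Finset in
lemma aux_fiber (K F : Type) [Field K] [Fintype K] [DecidableEq K] [Field F] [Fintype F]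
    [Algebra K F] (c : K) :
    (∑ y : F, if Algebra.trace K F y = c then (1:ℤ) else 0) * Fintype.card K = Fintype.card F := by
  have key : ∀ d : K, (∑ y : F, if Algebra.trace K F y = d then (1:ℤ) else 0)
      = ∑ y : F, if Algebra.trace K F y = c then (1:ℤ) else 0 := by
    intro d
    obtain ⟨z, hz⟩ := Algebra.trace_surjective K F (d - c)
    rw [← Equiv.sum_comp (Equiv.addRight z)]
    refine sum_congr rfl fun y _ => ?_
    simp only [Equiv.coe_addRight, map_add, hz]
    congr 1
    apply propext
    constructor <;> intro h <;> linear_combination h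
  have h2 : ∑ d : K, (∑ y : F, if Algebra.trace K F y = d then (1:ℤ) else 0)
      = Fintype.card F := by
    rw [sum_comm]; simp
  rw [sum_congr rfl (fun d _ => key d)] at h2
  rw [← h2]; simp [mul_comm]

open Finset in
lemma aux_H (K F : Type) [Field K] [Fintype K] [DecidableEq K] [Field F] [Fintype F]
    [DecidableEq F] [Algebra K F] (hc : Fintype.card F = Fintype.card K ^ 2)
    (hodd : Odd (Fintype.card K)) (k : K) (hk : k ≠ 0) :
    (∑ y : F, if Algebra.trace K F y = k then quadraticChar F y else 0)
      = (-1) ^ (Fintype.card K / 2) := by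
  have hfr : Module.finrank K F = 2 := by
    have h := Module.card_eq_pow_finrank (K := K) (V := F)
    rw [hc] at h
    exact (Nat.pow_right_injective (Fintype.one_lt_card (α := K)) h).symm
  obtain ⟨j, hj⟩ := hodd
  have hj2 : Fintype.card K / 2 = j := by omega
  have hF2 : Fintype.card F / 2 = 2 * j * (j + 1) := by
    rw [hc, hj]
    have : (2 * j + 1) ^ 2 = 2 * (2 * j * (j + 1)) + 1 := by ring
    omega
  have hchar : ringChar F ≠ 2 := by
    intro h
    have := FiniteField.even_card_of_char_two h
    rw [hc, hj] at this
    have h3 : (2 * j + 1) ^ 2 = 2 * (2 * j * (j + 1)) + 1 := by ring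
    omega
  have hscal : ∀ l : K, l ≠ 0 → quadraticChar F (algebraMap K F l) = 1 := by
    intro l hl
    rw [quadraticChar_eq_pow_of_char_ne_two hchar (by simpa using hl), hF2, pow_mul, ← map_pow]
    have : l ^ (2 * j) = 1 := by
      have := FiniteField.pow_card_sub_one_eq_one l hl
      rwa [hj] at this
    simp [this]
  have hcongr : ∀ l : K, l ≠ 0 →
      (∑ y : F, if Algebra.trace K F y = l then quadraticChar F y else 0)
      = (∑ y : F, if Algebra.trace K F y = k then quadraticChar F y else 0) := by
    intro l hl
    have hlk : l / k ≠ 0 := div_ne_zero hl hk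
    rw [← Equiv.sum_comp (Equiv.mulLeft₀ (algebraMap K F (l / k)) (by simpa using ⟨hl, hk⟩))]
    refine sum_congr rfl fun y _ => ?_
    simp only [Equiv.mulLeft₀_apply, map_mul, hscal _ hlk, one_mul]
    rw [← Algebra.smul_def, map_smul, smul_eq_mul]
    congr 1
    apply propext
    constructor
    · intro h
      field_simp at h
      exact h
    · rintro h
      rw [h]; field_simp
  have hker : (∑ y : F, if Algebra.trace K F y = 0 then quadraticChar F y else 0)
      = (-1) ^ (j + 1) * (2 * j) := by
    have h1 : ∀ y : F, (if Algebra.trace K F y = 0 then quadraticChar F y else 0)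
        = (-1) ^ (j + 1) * ((if Algebra.trace K F y = 0 then 1 else 0) - if y = 0 then 1 else 0) := by
      intro y
      by_cases hy : y = 0
      · simp [hy]
      by_cases ht : Algebra.trace K F y = 0
      · simp only [ht, hy, if_true, if_false, sub_zero, mul_one]
        have h := FiniteField.algebraMap_trace_eq_sum_pow K F y
        rw [hfr, ht, Nat.card_eq_fintype_card, hj] at h
        simp [sum_range_succ] at h
        have hp : y ^ (2 * j) = -1 := by
          have : y * (y ^ (2 * j) + 1) = 0 := by linear_combination -h
          rcases mul_eq_zero.mp this with h | h
          · exact absurd h hy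
          · linear_combination h
        rw [quadraticChar_eq_pow_of_char_ne_two hchar hy, hF2, pow_mul, hp]
        rcases Nat.even_or_odd (j + 1) with he | ho
        · simp [he.neg_one_pow]
        · have : (-1 : F) ≠ 1 := Ring.neg_one_ne_one_of_char_ne_two hchar
          simp [ho.neg_one_pow, this]
      · simp [hy, ht]
    have hf := aux_fiber K F 0
    rw [hc, hj] at hf
    have hf' : (∑ y : F, if Algebra.trace K F y = 0 then (1:ℤ) else 0) = 2 * j + 1 := by
      have h0 : ((2 * j + 1 : ℕ) : ℤ) ≠ 0 := by positivity
      apply mul_right_cancel₀ h0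
      rw [hf]; push_cast; ring
    rw [sum_congr rfl (fun y _ => h1 y), ← mul_sum, sum_sub_distrib, hf']
    simp
  have htot : ∑ l : K, (∑ y : F, if Algebra.trace K F y = l then quadraticChar F y else 0) = 0 := by
    rw [sum_comm]; simp [quadraticChar_sum_zero hchar, -quadraticChar_apply]
  rw [← add_sum_erase _ _ (mem_univ (0:K)), hker,
    sum_congr rfl (fun l hl => hcongr l (ne_of_mem_erase hl)), sum_const,
    card_erase_of_mem (mem_univ _), card_univ, hj] at htot
  have hjpos : (2 * j : ℤ) ≠ 0 := by
    have := Fintype.one_lt_card (α := K)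
    have : 0 < j := by omega
    positivity
  rw [hj2]
  apply mul_left_cancel₀ hjpos
  simp [-quadraticChar_apply] at htot
  rw [pow_succ] at htot
  linear_combination htot

open Finset in
lemma aux_h (p n : ℕ) [Fact p.Prime] (hp4 : p % 4 = 3) (hn : 1 ≤ n)
    (F : Type) [Field F] [Fintype F] [DecidableEq F] [Algebra (ZMod p) F]
    (hcard : Fintype.card F = p ^ (2 * n)) (ρ : ZMod p) (hρ : ρ ≠ 0) :
    (∑ y : F, if Algebra.trace (ZMod p) F y = ρ then quadraticChar F y else 0)
      = (-1) ^ n * p ^ (n - 1) := by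
  have hp : 1 < p := (Fact.out : p.Prime).one_lt
  have hfrF : Module.finrank (ZMod p) F = 2 * n := by
    have h := Module.card_eq_pow_finrank (K := ZMod p) (V := F)
    rw [hcard, ZMod.card] at h
    exact (Nat.pow_right_injective hp h).symm
  classical
  let K := GaloisField p n
  have hfrK : Module.finrank (ZMod p) K = n := GaloisField.finrank p (by omega)
  obtain ⟨φ⟩ : Nonempty (K →ₐ[ZMod p] F) := by
    apply FiniteField.nonempty_algHom_of_finrank_dvd
    rw [hfrK, hfrF]; exact Dvd.intro_left 2 rfl
  let _ : Algebra K F := φ.toRingHom.toAlgebra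
  have : IsScalarTower (ZMod p) K F := IsScalarTower.of_algebraMap_eq (fun x => (φ.commutes x).symm)
  let _ : Fintype K := Fintype.ofFinite K
  have hcK : Fintype.card K = p ^ n := by
    rw [← Nat.card_eq_fintype_card]; exact GaloisField.card p n (by omega)
  have hpodd : Odd p := Nat.odd_iff.mpr (by omega)
  have hH := aux_H K F (by rw [hcard, hcK, ← pow_mul, mul_comm]) (by rw [hcK]; exact hpodd.pow)
  have hsign : (-1 : ℤ) ^ (Fintype.card K / 2) = (-1) ^ n := by
    have h4 : p ^ n % 4 = if Even n then 1 else 3 := by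
      exact aux_mod4 p hp4 n
    rw [hcK]
    by_cases h : Even n
    · rw [if_pos h] at h4
      rw [h.neg_one_pow, Even.neg_one_pow]
      exact Nat.even_iff.mpr (by omega)
    · rw [if_neg h] at h4
      rw [(Nat.not_even_iff_odd.mp h).neg_one_pow, Odd.neg_one_pow]
      exact Nat.odd_iff.mpr (by omega)
  have hstep : (∑ y : F, if Algebra.trace (ZMod p) F y = ρ then quadraticChar F y else 0)
      = ∑ k : K, if Algebra.trace (ZMod p) K k = ρ then
        (∑ y : F, if Algebra.trace K F y = k then quadraticChar F y else 0) else 0 := by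
    have : ∀ k : K, (if Algebra.trace (ZMod p) K k = ρ then
        (∑ y : F, if Algebra.trace K F y = k then quadraticChar F y else 0) else 0)
        = ∑ y : F, if Algebra.trace K F y = k then
          (if Algebra.trace (ZMod p) K k = ρ then quadraticChar F y else 0) else 0 := by
      intro k; split_ifs <;> simp
    rw [sum_congr rfl (fun k _ => this k), sum_comm]
    simp [Algebra.trace_trace]
  have hstep2 : ∀ k : K, (if Algebra.trace (ZMod p) K k = ρ then
        (∑ y : F, if Algebra.trace K F y = k then quadraticChar F y else 0) else 0)
        = (-1) ^ n * (if Algebra.trace (ZMod p) K k = ρ then 1 else 0) := by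
    intro k
    split_ifs with h
    · rw [hH k (by rintro rfl; exact hρ (by rw [← h, map_zero])), hsign, mul_one]
    · simp
  rw [hstep, sum_congr rfl (fun k _ => hstep2 k), ← mul_sum]
  congr 1
  have hf := aux_fiber (ZMod p) K ρ
  rw [hcK, ZMod.card] at hf
  have h0 : (p : ℤ) ≠ 0 := by positivity
  apply mul_right_cancel₀ h0
  rw [hf, ← pow_succ, Nat.sub_add_cancel hn]
  push_cast; rfl

open Finset in
lemma aux_f (p n : ℕ) [Fact p.Prime] (hp4 : p % 4 = 3) (hn : 1 ≤ n)
    (F : Type) [Field F] [Fintype F] [DecidableEq F] [Algebra (ZMod p) F]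
    (hcard : Fintype.card F = p ^ (2 * n)) (a : F) (ha : a ≠ 0) (ρ : ZMod p) (hρ : ρ ≠ 0) :
    (∑ x : F, if Algebra.trace (ZMod p) F (a * x ^ 2) = ρ then (1:ℤ) else 0)
      = p ^ (2 * n - 1) + quadraticChar F a * (-1) ^ n * p ^ (n - 1) := by
  have hp : 1 < p := (Fact.out : p.Prime).one_lt
  have hchar : ringChar F ≠ 2 := by
    intro h
    have := FiniteField.even_card_of_char_two h
    have hpodd : Odd p := Nat.odd_iff.mpr (by omega)
    rw [hcard] at this
    have := Nat.odd_iff.mp (hpodd.pow (n := 2 * n))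
    omega
  have h1 : (∑ x : F, if Algebra.trace (ZMod p) F (a * x ^ 2) = ρ then (1:ℤ) else 0)
      = ∑ y : F, if Algebra.trace (ZMod p) F (a * y) = ρ then (quadraticChar F y + 1) else 0 := by
    have : ∀ y : F, (if Algebra.trace (ZMod p) F (a * y) = ρ then (quadraticChar F y + 1) else 0)
        = ∑ x : F, if x ^ 2 = y then
          (if Algebra.trace (ZMod p) F (a * y) = ρ then (1:ℤ) else 0) else 0 := by
      intro y
      rw [← quadraticChar_card_sqrts hchar y]
      split_ifs <;> simp
    rw [sum_congr rfl (fun k _ => this k), sum_comm]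
    simp
  have h2 : quadraticChar F a⁻¹ = quadraticChar F a := by
    have h3 : quadraticChar F a * quadraticChar F a⁻¹ = 1 := by
      rw [← map_mul, mul_inv_cancel₀ ha, map_one]
    rcases quadraticChar_dichotomy ha with h | h <;> rw [h] at h3 ⊢ <;> linarith
  rw [h1, ← Equiv.sum_comp (Equiv.mulLeft₀ a⁻¹ (inv_ne_zero ha))]
  have h3 : ∀ y : F, (if Algebra.trace (ZMod p) F (a * (Equiv.mulLeft₀ a⁻¹ (inv_ne_zero ha) y)) = ρ
      then (quadraticChar F (Equiv.mulLeft₀ a⁻¹ (inv_ne_zero ha) y) + 1) else 0)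
      = quadraticChar F a * (if Algebra.trace (ZMod p) F y = ρ then quadraticChar F y else 0)
        + if Algebra.trace (ZMod p) F y = ρ then 1 else 0 := by
    intro y
    simp only [Equiv.mulLeft₀_apply, mul_inv_cancel_left₀ ha, map_mul, h2]
    split_ifs <;> simp
  rw [sum_congr rfl (fun k _ => h3 k), sum_add_distrib, ← mul_sum, aux_h p n hp4 hn F hcard ρ hρ]
  have hf := aux_fiber (ZMod p) F ρ
  rw [hcard, ZMod.card] at hf
  have h0 : (p : ℤ) ≠ 0 := by positivity
  have : (∑ y : F, if Algebra.trace (ZMod p) F y = ρ then (1:ℤ) else 0) = p ^ (2 * n - 1) := by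
    apply mul_right_cancel₀ h0
    rw [hf, ← pow_succ, Nat.sub_add_cancel (by omega)]
    push_cast; rfl
  rw [this]; ring

open Finset in
lemma aux_conic (p : ℕ) [Fact p.Prime] (hp4 : p % 4 = 3) :
    ∑ c : ZMod p, quadraticChar (ZMod p) (1 - c ^ 2) = 1 := by
  have hchar : ringChar (ZMod p) ≠ 2 := by
    rw [ZMod.ringChar_zmod_n]; omega
  have h1 : ∑ c : ZMod p, quadraticChar (ZMod p) (1 - c ^ 2)
      = ∑ w : ZMod p, (quadraticChar (ZMod p) w + 1) * quadraticChar (ZMod p) (1 - w) := by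
    have : ∀ w : ZMod p, (quadraticChar (ZMod p) w + 1) * quadraticChar (ZMod p) (1 - w)
        = ∑ c : ZMod p, if c ^ 2 = w then quadraticChar (ZMod p) (1 - w) else 0 := by
      intro w
      rw [← quadraticChar_card_sqrts hchar w]
      simp [-quadraticChar_apply, ← sum_filter]
    rw [sum_congr rfl (fun k _ => this k), sum_comm]
    simp [-quadraticChar_apply]
  have hJ : ∑ w : ZMod p, quadraticChar (ZMod p) w * quadraticChar (ZMod p) (1 - w) = 1 := by
    have h := jacobiSum_nontrivial_inv (quadraticChar_ne_one hchar)
    rw [(quadraticChar_isQuadratic (ZMod p)).inv, jacobiSum] at h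
    rw [h, quadraticChar_neg_one hchar, ZMod.card, ZMod.χ₄_nat_three_mod_four hp4]
    norm_num
  have h0 : ∑ w : ZMod p, quadraticChar (ZMod p) (1 - w) = 0 := by
    rw [← quadraticChar_sum_zero hchar]
    exact Equiv.sum_comp (Equiv.subLeft (1 : ZMod p)) (fun w => quadraticChar (ZMod p) w)
  rw [h1]
  simp only [add_mul, one_mul, sum_add_distrib, hJ, h0, add_zero]

open Finset in
/-- Abstract determination of the hyperplane counts from the total counts. -/
lemma aux_solve (p : ℕ) [Fact p.Prime] (hp4 : p % 4 = 3) (t : ZMod p) (ht : t ≠ 0)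
    (f g : ZMod p → ℤ) (P δ : ℤ)
    (hfg : ∀ s, f s = ∑ c : ZMod p, g (s - c ^ 2 * t))
    (hg : ∀ k s : ZMod p, k ≠ 0 → g (k ^ 2 * s) = g s)
    (hsum : ∑ s, g s = p * P)
    (hft : ∀ s, s ≠ 0 → f s = p * P + δ) (hfsum : ∑ s, f s = p * (p * P)) (s : ZMod p) :
    (quadraticChar (ZMod p) (s * t) = 1 → g s = P + δ) ∧
    (quadraticChar (ZMod p) (s * t) = -1 → g s = P - δ) := by
  have hchar : ringChar (ZMod p) ≠ 2 := by
    rw [ZMod.ringChar_zmod_n]; omega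
  have hp : 1 < p := (Fact.out : p.Prime).one_lt
  have hm1 : quadraticChar (ZMod p) (-1) = -1 := by
    rw [quadraticChar_neg_one hchar, ZMod.card, ZMod.χ₄_nat_three_mod_four hp4]
  have hsq : ∀ u : ZMod p, u ≠ 0 → quadraticChar (ZMod p) u = 1 → g (u * t) = g t := by
    intro u hu h
    obtain ⟨k, hk⟩ := (quadraticChar_one_iff_isSquare hu).mp h
    rw [hk, ← pow_two, hg]
    rintro rfl; simp at hk; exact hu hk
  have hnsq : ∀ u : ZMod p, u ≠ 0 → quadraticChar (ZMod p) u = -1 → g (u * t) = g (-t) := by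
    intro u hu h
    have : quadraticChar (ZMod p) (-u) = 1 := by
      rw [← neg_one_mul, map_mul, hm1, h]; norm_num
    obtain ⟨k, hk⟩ := (quadraticChar_one_iff_isSquare (neg_ne_zero.mpr hu)).mp this
    have h2 : u * t = k ^ 2 * (-t) := by linear_combination (-t) * hk
    rw [h2, hg]
    rintro rfl; simp at hk; exact hu hk
  have hform : ∀ u : ZMod p, 2 * g (u * t) = (g t + g (-t))
      + (g t - g (-t)) * quadraticChar (ZMod p) u
      + (2 * g 0 - g t - g (-t)) * if u = 0 then 1 else 0 := by
    intro u
    by_cases hu : u = 0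
    · subst hu; simp
    · rcases quadraticChar_dichotomy hu with h | h
      · rw [hsq u hu h, h, if_neg hu]; ring
      · rw [hnsq u hu h, h, if_neg hu]; ring
  -- value at zero
  have hf0 : f 0 = g 0 + (p - 1) * g (-t) := by
    rw [hfg, ← add_sum_erase _ _ (mem_univ (0 : ZMod p)),
      sum_congr rfl (g := fun _ => g (-t)), sum_const, card_erase_of_mem (mem_univ _), card_univ,
      ZMod.card]
    · simp [Nat.cast_sub hp.le]
    · intro c hc
      rw [← hg c (-t) (ne_of_mem_erase hc)]
      congr 1; ring
  have hf0' : f 0 = p * P - (p - 1) * δ := by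
    rw [← add_sum_erase _ _ (mem_univ (0 : ZMod p)),
      sum_congr rfl (fun s hs => hft s (ne_of_mem_erase hs)), sum_const,
      card_erase_of_mem (mem_univ _), card_univ, ZMod.card] at hfsum
    simp [Nat.cast_sub hp.le] at hfsum
    linear_combination hfsum
  have htot : 2 * (p * P) = p * (g t + g (-t)) + (2 * g 0 - g t - g (-t)) := by
    rw [← hsum, ← Equiv.sum_comp (Equiv.mulRight₀ t ht), mul_sum]
    simp only [Equiv.mulRight₀_apply, hform, sum_add_distrib, ← mul_sum,
      quadraticChar_sum_zero hchar]
    simp [ZMod.card]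
    ring
  have hone : 2 * (p * P + δ) = p * (g t + g (-t)) + (g t - g (-t))
      + 2 * (2 * g 0 - g t - g (-t)) := by
    rw [← hft t ht, hfg, mul_sum]
    have h1 : ∀ c : ZMod p, t - c ^ 2 * t = (1 - c ^ 2) * t := fun c => by ring
    simp only [h1, hform, sum_add_distrib, ← mul_sum, aux_conic p hp4]
    have h2 : ∑ c : ZMod p, (if 1 - c ^ 2 = 0 then (1:ℤ) else 0) = 2 := by
      have h3 := quadraticChar_card_sqrts hchar 1
      rw [map_one] at h3
      have h4 : ∀ c : ZMod p, (1 - c ^ 2 = 0) ↔ c ^ 2 = 1 := fun c => by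
        rw [sub_eq_zero, eq_comm]
      simp only [h4]
      rw [← sum_filter, sum_const, nsmul_eq_mul, mul_one]
      rw [show (2:ℤ) = 1 + 1 by norm_num, ← h3]
      congr 2
      ext c; simp
    rw [h2]
    simp [ZMod.card]
    ring
  have hp0 : (p : ℤ) ≠ 0 := by positivity
  have hg0m : g 0 - g (-t) = δ := by linarith
  have hg0 : g 0 = P := by
    apply mul_left_cancel₀ hp0
    linear_combination hf0' - hf0 + (p - 1) * hg0m
  have hgm : g (-t) = P - δ := by linarith
  have hp1 : (p - 1 : ℤ) ≠ 0 := by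
    have : (1 : ℤ) < p := by exact_mod_cast hp
    linarith
  have hgp : g t = P + δ := by
    apply mul_left_cancel₀ hp1
    linear_combination -htot - (p - 1) * hgm - 2 * hg0
  have hcv : quadraticChar (ZMod p) (s * t) = quadraticChar (ZMod p) (s / t) := by
    have : s * t = (s / t) * t ^ 2 := by field_simp
    rw [this, map_mul, quadraticChar_sq_one' ht, mul_one]
  have hs : s = s / t * t := by field_simp
  rw [hcv]
  constructor
  · intro h
    have h0 : s / t ≠ 0 := by rintro h0; rw [h0] at h; simp at h
    rw [hs, hsq _ h0 h, hgp]
  · intro h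
    have h0 : s / t ≠ 0 := by rintro h0; rw [h0] at h; simp at h
    rw [hs, hnsq _ h0 h, hgm]

/-- `p ≡ 3 (mod 4)`, `m` even, `a ∈ F_r^*` with `Tr(a⁻¹) ≠ 0`,
`ρ ∈ F_p^*`.  Then `N(ρ) = N_1(ρ)`, with `N(ρ) = (p-1)p^{m-2}/2` if
`η̄(ρ Tr(a⁻¹)) = 1` and `N(ρ) = (p-1)p^{m-2}/2 + η(a)(-1)^{m/2} p^{(m-2)/2}` if
`η̄(ρ Tr(a⁻¹)) = -1`. -/
theorem stmt_18 (p m : ℕ) [Fact p.Prime] (hp4 : p % 4 = 3) (hm : 2 ≤ m) (hme : Even m)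
    (F : Type) [Field F] [Fintype F] [DecidableEq F] [Algebra (ZMod p) F]
    (hcard : Fintype.card F = p ^ m)
    (a : F) (ha : a ≠ 0) (hTr : Algebra.trace (ZMod p) F a⁻¹ ≠ 0)
    (ρ : ZMod p) (hρ : ρ ≠ 0) :
    Nsq' p F a ρ = Nnsq p F a ρ ∧
    (quadraticChar (ZMod p) (ρ * Algebra.trace (ZMod p) F a⁻¹) = 1 →
      (Nsq' p F a ρ : ℤ) = (p - 1) / 2 * p ^ (m - 2)) ∧
    (quadraticChar (ZMod p) (ρ * Algebra.trace (ZMod p) F a⁻¹) = -1 →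
      (Nsq' p F a ρ : ℤ) = (p - 1) / 2 * p ^ (m - 2)
        + quadraticChar F a * (-1) ^ (m / 2) * p ^ ((m - 2) / 2)) := by
  classical
  obtain ⟨n, hn⟩ := hme
  have hmn : m = 2 * n := by omega
  subst hmn
  have hn1 : 1 ≤ n := by omega
  have hp : 1 < p := (Fact.out : p.Prime).one_lt
  set T := Algebra.trace (ZMod p) F with hT
  set t := T a⁻¹ with ht
  let f : ZMod p → ℤ := fun s => ∑ x : F, if T (a * x ^ 2) = s then (1:ℤ) else 0
  let g : ZMod p → ℤ := fun s => ∑ x : F, if T x = 0 ∧ T (a * x ^ 2) = s then (1:ℤ) else 0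
  have hsm : ∀ (c : ZMod p) (x : F), T (algebraMap (ZMod p) F c * x) = c * T x := by
    intro c x
    rw [← Algebra.smul_def, map_smul, smul_eq_mul]
  have hfg : ∀ s, f s = ∑ c : ZMod p, g (s - c ^ 2 * t) := by
    intro s
    have h1 : ∀ c : ZMod p, g (s - c ^ 2 * t)
        = ∑ x : F, if T x * t⁻¹ = c then (if T (a * x ^ 2) = s then (1:ℤ) else 0) else 0 := by
      intro c
      rw [← Equiv.sum_comp (Equiv.addRight (algebraMap (ZMod p) F c * a⁻¹))]
      refine Finset.sum_congr rfl fun x _ => ?_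
      have e1 : T (x + algebraMap (ZMod p) F c * a⁻¹) = T x + c * t := by
        rw [map_add, hsm]
      have e2 : T (a * (x + algebraMap (ZMod p) F c * a⁻¹) ^ 2)
          = T (a * x ^ 2) + 2 * c * T x + c ^ 2 * t := by
        have : a * (x + algebraMap (ZMod p) F c * a⁻¹) ^ 2
            = a * x ^ 2 + algebraMap (ZMod p) F (2 * c) * x
              + algebraMap (ZMod p) F (c ^ 2) * a⁻¹ := by
          simp only [map_mul, map_pow, map_ofNat]
          field_simp
          ring
        rw [this, map_add, map_add, hsm, hsm]
      simp only [Equiv.coe_addRight, e1, e2]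
      have e3 : (T x + c * t) * t⁻¹ = c ↔ T x = 0 := by
        constructor
        · intro h
          field_simp at h
          linear_combination h
        · intro h; rw [h]; field_simp; ring
      by_cases hx : T x = 0
      · simp only [e3]
        simp only [hx, true_and, if_true, mul_zero, add_zero]
        congr 1
        apply propext
        constructor <;> intro h <;> linear_combination h
      · simp [e3, hx]
    rw [Finset.sum_congr rfl (fun c _ => h1 c), Finset.sum_comm]
    simp [f]
  have hg : ∀ k s : ZMod p, k ≠ 0 → g (k ^ 2 * s) = g s := by
    intro k s hk
    have hk' : algebraMap (ZMod p) F k ≠ 0 := by simpa using hk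
    simp only [g]
    rw [← Equiv.sum_comp (Equiv.mulLeft₀ (algebraMap (ZMod p) F k) hk')]
    refine Finset.sum_congr rfl fun x _ => ?_
    simp only [Equiv.mulLeft₀_apply]
    have e : a * (algebraMap (ZMod p) F k * x) ^ 2
        = algebraMap (ZMod p) F (k ^ 2) * (a * x ^ 2) := by
      rw [map_pow]; ring
    rw [e, hsm, hsm]
    simp [hk]
  have hpz : (p : ℤ) ≠ 0 := by positivity
  have hsum : ∑ s, g s = p * (p : ℤ) ^ (2 * n - 2) := by
    have hf := aux_fiber (ZMod p) F 0
    rw [hcard, ZMod.card] at hf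
    have h2 : ∑ s, g s = ∑ x : F, if T x = 0 then (1:ℤ) else 0 := by
      simp only [g]
      rw [Finset.sum_comm]
      refine Finset.sum_congr rfl fun x _ => ?_
      by_cases hx : T x = 0 <;> simp [hx]
    rw [h2]
    apply mul_right_cancel₀ hpz
    rw [hf]
    conv_lhs => rw [show 2 * n = 2 * n - 2 + 2 by omega]
    push_cast; ring
  have hft : ∀ s, s ≠ 0 → f s = p * (p : ℤ) ^ (2 * n - 2)
      + quadraticChar F a * (-1) ^ n * p ^ (n - 1) := by
    intro s hs
    have := aux_f p n hp4 hn1 F hcard a ha s hs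
    rw [show 2 * n - 1 = (2 * n - 2) + 1 by omega, pow_succ'] at this
    exact this
  have hfsum : ∑ s, f s = p * (p * (p : ℤ) ^ (2 * n - 2)) := by
    simp only [f]
    rw [Finset.sum_comm]
    simp only [Finset.sum_ite_eq, Finset.mem_univ, if_true, Finset.sum_const, nsmul_eq_mul,
      mul_one, Finset.card_univ, hcard]
    conv_lhs => rw [show 2 * n = 2 * n - 2 + 2 by omega]
    push_cast; ring
  have hsolve := aux_solve p hp4 t hTr f g _ _ hfg hg hsum hft hfsum ρ
  have hneg : ¬ IsSquare (-1 : ZMod p) := by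
    rw [ZMod.exists_sq_eq_neg_one_iff]; simpa using hp4
  have hsqneg : ∀ u : ZMod p, u ≠ 0 → (IsSquare (-u) ↔ ¬ IsSquare u) := by
    intro u hu
    have hchar : ringChar (ZMod p) ≠ 2 := by
      rw [ZMod.ringChar_zmod_n]; omega
    have hm1 : quadraticChar (ZMod p) (-1) = -1 := by
      rw [quadraticChar_neg_one hchar, ZMod.card, ZMod.χ₄_nat_three_mod_four hp4]
    rw [← quadraticChar_one_iff_isSquare hu,
      ← quadraticChar_one_iff_isSquare (neg_ne_zero.mpr hu), ← neg_one_mul, map_mul, hm1]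
    rcases quadraticChar_dichotomy hu with h | h <;> rw [h] <;> norm_num
  have hN : (Nsq' p F a ρ : ℤ)
      = ∑ x : F, if (IsSquare (T x) ∧ T x ≠ 0) ∧ T (a * x ^ 2) = ρ then (1:ℤ) else 0 := by
    rw [Nsq', Set.ncard_eq_toFinset_card']
    simp [T]
  have hN1 : (Nnsq p F a ρ : ℤ)
      = ∑ x : F, if ¬ IsSquare (T x) ∧ T (a * x ^ 2) = ρ then (1:ℤ) else 0 := by
    rw [Nnsq, Set.ncard_eq_toFinset_card']
    simp [T]
  have heq : (Nsq' p F a ρ : ℤ) = Nnsq p F a ρ := by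
    rw [hN, hN1, ← Equiv.sum_comp (Equiv.neg F)]
    refine Finset.sum_congr rfl fun x _ => ?_
    simp only [Equiv.neg_apply, map_neg, neg_sq]
    by_cases hx : T x = 0
    · simp [hx]
    · simp [hx, hsqneg]
  have htotal : (Nsq' p F a ρ : ℤ) + Nnsq p F a ρ + g ρ = f ρ := by
    rw [hN, hN1]
    simp only [f, g]
    rw [← Finset.sum_add_distrib, ← Finset.sum_add_distrib]
    refine Finset.sum_congr rfl fun x _ => ?_
    by_cases hx : T x = 0
    · simp [hx]
    · by_cases hs : IsSquare (T x) <;> simp [hx, hs]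
  rw [← heq, hft ρ hρ] at htotal
  have hhalf : 2 * (((p : ℤ) - 1) / 2) = p - 1 := by omega
  have en : 2 * n / 2 = n := by omega
  have en' : (2 * n - 2) / 2 = n - 1 := by omega
  refine ⟨by exact_mod_cast heq, fun h => ?_, fun h => ?_⟩
  · have h1 := hsolve.1 h
    apply mul_left_cancel₀ (two_ne_zero (α := ℤ))
    rw [← mul_assoc, hhalf]
    linear_combination htotal - h1
  · have h1 := hsolve.2 h
    rw [en, en']
    apply mul_left_cancel₀ (two_ne_zero (α := ℤ))
    rw [mul_add, ← mul_assoc, hhalf]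
    linear_combination htotal - h1
end

section
/- Suppose p ≡ 3 (mod 4) and m ≥ 3 is odd. Let a ∈ F_r^* with Tr(a^{−1}) ≠ 0 and let ρ ∈ F_p^*. Then N(ρ) = N_1(ρ) = (p−1)p^{m−2}/2 + (1/2)·η(a)·(−1)^{(m−1)/2}·p^{(m−3)/2}·(p·η̄(ρ) + η̄(Tr(a^{−1}))). -/
section gaussPart
variable {p : ℕ} [Fact p.Prime]

lemma addChar_sum (ψ : AddChar (ZMod p) ℂ) {ι : Type} (s : Finset ι) (f : ι → ZMod p) :
    ψ (∑ i ∈ s, f i) = ∏ i ∈ s, ψ (f i) := by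
  classical
  induction s using Finset.induction_on with
  | empty => simp
  | insert a s ha ih => rw [Finset.sum_insert ha, Finset.prod_insert ha, AddChar.map_add_eq_mul, ih]

/-- the complex quadratic character -/
noncomputable def cchi (p : ℕ) [Fact p.Prime] : MulChar (ZMod p) ℂ :=
  (quadraticChar (ZMod p)).ringHomComp (Int.castRingHom ℂ)

/-- the quadratic Gauss sum -/
noncomputable def gsum (p : ℕ) [Fact p.Prime] : ℂ := gaussSum (cchi p) ZMod.stdAddChar

lemma cchi_apply (b : ZMod p) : cchi p b = (quadraticChar (ZMod p) b : ℂ) := rfl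

lemma cchi_ne_one (hp : p ≠ 2) : cchi p ≠ 1 := by
  have h2 : ringChar (ZMod p) ≠ 2 := by rwa [ZMod.ringChar_zmod_n]
  rw [cchi, MulChar.ringHomComp_ne_one_iff (RingHom.injective_int _)]
  exact quadraticChar_ne_one h2

lemma cchi_isQuadratic : (cchi p).IsQuadratic :=
  (quadraticChar_isQuadratic (ZMod p)).comp _

lemma gsum_sq (hp4 : p % 4 = 3) : gsum p ^ 2 = -(p : ℂ) := by
  have hp : p ≠ 2 := by omega
  rw [gsum, gaussSum_sq (χ := cchi p) (cchi_ne_one hp) cchi_isQuadratic (ZMod.isPrimitive_stdAddChar p)]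
  have : quadraticChar (ZMod p) (-1) = -1 := by
    rw [quadraticChar_neg_one_iff_not_isSquare, FiniteField.isSquare_neg_one_iff]
    simpa using hp4
  rw [cchi_apply, this]
  simp [ZMod.card]

lemma gauss_shift (b : ZMod p) (hb : b ≠ 0) :
    ∑ u, cchi p u * ZMod.stdAddChar (b * u) = cchi p b * gsum p := by
  have h := gaussSum_mulShift_eq (cchi p) (ZMod.stdAddChar (N := p)) (Units.mk0 b hb)
  rw [cchi_isQuadratic.inv] at h
  simpa [gaussSum, gsum] using h

lemma sum_psi (b : ZMod p) (hb : b ≠ 0) :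
    ∑ u : ZMod p, (ZMod.stdAddChar (b * u) : ℂ) = 0 := by
  have := AddChar.sum_mulShift b (ZMod.isPrimitive_stdAddChar p)
  simp only [hb, if_false] at this
  simpa [mul_comm] using this

lemma sum_sq (hp : p ≠ 2) (b : ZMod p) (hb : b ≠ 0) :
    ∑ x : ZMod p, (ZMod.stdAddChar (b * x ^ 2) : ℂ) = cchi p b * gsum p := by
  have h2 : ringChar (ZMod p) ≠ 2 := by rwa [ZMod.ringChar_zmod_n]
  rw [← Finset.sum_fiberwise_of_maps_to (s := Finset.univ) (t := Finset.univ)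
    (g := fun x : ZMod p => x ^ 2) (fun _ _ => Finset.mem_univ _)]
  have : ∀ u : ZMod p, ∑ x ∈ Finset.univ.filter (fun x : ZMod p => x ^ 2 = u),
      (ZMod.stdAddChar (b * x ^ 2) : ℂ) =
      ZMod.stdAddChar (b * u) + cchi p u * ZMod.stdAddChar (b * u) := by
    intro u
    rw [Finset.sum_congr rfl (g := fun _ => (ZMod.stdAddChar (b * u) : ℂ))]
    · rw [Finset.sum_const, nsmul_eq_mul]
      have h := quadraticChar_card_sqrts h2 u
      have h' : ((Finset.univ.filter (fun x : ZMod p => x ^ 2 = u)).card : ℤ)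
          = quadraticChar (ZMod p) u + 1 := by
        rw [← h]; congr 2; ext; simp
      have h'' : ((Finset.univ.filter (fun x : ZMod p => x ^ 2 = u)).card : ℂ)
          = cchi p u + 1 := by
        rw [cchi_apply]; exact_mod_cast h'
      rw [h'']; ring
    · intro x hx
      simp only [Finset.mem_filter] at hx
      rw [hx.2]
  rw [Finset.sum_congr rfl (fun u _ => this u), Finset.sum_add_distrib, sum_psi b hb,
    gauss_shift b hb, zero_add]

lemma count_gen (hp : p ≠ 2) (n : ℕ) (hn : n ≠ 0) (w : Fin n → ZMod p) (hw : ∀ i, w i ≠ 0)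
    (ρ : ZMod p) :
    (p : ℂ) * (Finset.univ.filter (fun x : Fin n → ZMod p => ∑ i, w i * x i ^ 2 = ρ)).card =
      (p : ℂ) ^ n + cchi p (∏ i, w i) * gsum p ^ n *
        ∑ y : ZMod p, cchi p y ^ n * ZMod.stdAddChar (-ρ * y) := by
  have h1 : (p : ℂ) * (Finset.univ.filter
      (fun x : Fin n → ZMod p => ∑ i, w i * x i ^ 2 = ρ)).card =
      ∑ x : Fin n → ZMod p, ∑ y : ZMod p,
        (ZMod.stdAddChar (y * (∑ i, w i * x i ^ 2 - ρ)) : ℂ) := by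
    simp_rw [AddChar.sum_mulShift _ (ZMod.isPrimitive_stdAddChar p), sub_eq_zero, ZMod.card]
    rw [Finset.card_filter]
    push_cast
    rw [Finset.mul_sum]
    refine Finset.sum_congr rfl fun x _ => ?_
    split_ifs <;> simp
  have h2 : ∀ y : ZMod p, ∑ x : Fin n → ZMod p,
        (ZMod.stdAddChar (y * (∑ i, w i * x i ^ 2 - ρ)) : ℂ) =
        (∏ i, ∑ t : ZMod p, (ZMod.stdAddChar (y * w i * t ^ 2) : ℂ)) *
          ZMod.stdAddChar (-ρ * y) := by
    intro y
    rw [Finset.prod_univ_sum, Finset.sum_mul]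
    simp only [Fintype.piFinset_univ]
    refine Finset.sum_congr rfl fun x _ => ?_
    rw [← addChar_sum, ← AddChar.map_add_eq_mul]
    congr 1
    rw [mul_sub, Finset.mul_sum]
    simp only [mul_assoc]
    ring
  rw [h1, Finset.sum_comm, Finset.sum_congr rfl (fun y _ => h2 y),
    ← Finset.add_sum_erase _ _ (Finset.mem_univ (0 : ZMod p)),
    ← Finset.add_sum_erase _ (fun y => cchi p y ^ n * _) (Finset.mem_univ (0 : ZMod p))]
  congr 1
  · simp [ZMod.card]
  · rw [MulChar.map_zero, zero_pow hn, zero_mul, zero_add, Finset.mul_sum]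
    refine Finset.sum_congr rfl fun y hy => ?_
    have hy0 : y ≠ 0 := Finset.ne_of_mem_erase hy
    rw [Finset.prod_congr rfl (fun i _ => sum_sq hp (y * w i) (mul_ne_zero hy0 (hw i)))]
    simp only [map_mul, Finset.prod_mul_distrib, Finset.prod_const, Finset.card_univ,
      Fintype.card_fin, map_prod]
    ring

lemma cchi_sq (y : ZMod p) (hy : y ≠ 0) : cchi p y ^ 2 = 1 := by
  rw [cchi_apply]; exact_mod_cast quadraticChar_sq_one hy

lemma count_odd (hp4 : p % 4 = 3) (k : ℕ) (w : Fin (2 * k + 1) → ZMod p)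
    (hw : ∀ i, w i ≠ 0) (ρ : ZMod p) (hρ : ρ ≠ 0) :
    ((Finset.univ.filter (fun x : Fin (2 * k + 1) → ZMod p => ∑ i, w i * x i ^ 2 = ρ)).card : ℤ) =
      (p : ℤ) ^ (2 * k) + quadraticChar (ZMod p) (∏ i, w i) * quadraticChar (ZMod p) ρ
        * (-1) ^ k * p ^ k := by
  have hp0 : (p : ℂ) ≠ 0 := by exact_mod_cast (Fact.out : p.Prime).ne_zero
  have h := count_gen (by omega) (2 * k + 1) (by omega) w hw ρ
  have h3 : ∀ y : ZMod p, cchi p y ^ (2 * k + 1) = cchi p y := by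
    intro y
    by_cases hy : y = 0
    · rw [hy, MulChar.map_zero, zero_pow (by omega)]
    · rw [pow_succ, pow_mul, cchi_sq y hy]; simp
  simp only [h3] at h
  rw [gauss_shift (-ρ) (neg_ne_zero.2 hρ)] at h
  have hm : quadraticChar (ZMod p) (-1) = -1 := by
    rw [quadraticChar_neg_one_iff_not_isSquare, FiniteField.isSquare_neg_one_iff]
    simpa using hp4
  have h5 : cchi p (-ρ) = - cchi p ρ := by
    rw [neg_eq_neg_one_mul, map_mul, cchi_apply (-1), hm]; simp
  have h6 : gsum p ^ (2 * k + 1) * gsum p = (-1) ^ (k + 1) * (p : ℂ) ^ (k + 1) := by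
    rw [← pow_succ, show 2 * k + 1 + 1 = 2 * (k + 1) by ring, pow_mul, gsum_sq hp4, neg_pow]
  have : ((Finset.univ.filter
      (fun x : Fin (2 * k + 1) → ZMod p => ∑ i, w i * x i ^ 2 = ρ)).card : ℂ) =
      (p : ℂ) ^ (2 * k) + cchi p (∏ i, w i) * cchi p ρ * (-1) ^ k * p ^ k := by
    apply mul_left_cancel₀ hp0
    rw [h, h5]
    linear_combination (-cchi p (∏ i, w i) * cchi p ρ) * h6
  simp only [cchi_apply] at this
  exact_mod_cast this

lemma count_even (hp4 : p % 4 = 3) (k : ℕ) (w : Fin (2 * k + 2) → ZMod p)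
    (hw : ∀ i, w i ≠ 0) (ρ : ZMod p) (hρ : ρ ≠ 0) :
    ((Finset.univ.filter (fun x : Fin (2 * k + 2) → ZMod p => ∑ i, w i * x i ^ 2 = ρ)).card : ℤ) =
      (p : ℤ) ^ (2 * k + 1) + quadraticChar (ZMod p) (∏ i, w i) * (-1) ^ k * p ^ k := by
  have hp0 : (p : ℂ) ≠ 0 := by exact_mod_cast (Fact.out : p.Prime).ne_zero
  have h := count_gen (by omega) (2 * k + 2) (by omega) w hw ρ
  have h3 : ∑ y : ZMod p, cchi p y ^ (2 * k + 2) * (ZMod.stdAddChar (-ρ * y) : ℂ) = -1 := by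
    have h0 := sum_psi (-ρ) (neg_ne_zero.2 hρ)
    rw [← Finset.add_sum_erase _ _ (Finset.mem_univ (0 : ZMod p))] at h0 ⊢
    rw [Finset.sum_congr rfl (g := fun y => (ZMod.stdAddChar (-ρ * y) : ℂ))]
    · simp only [mul_zero, AddChar.map_zero_eq_one] at h0
      rw [MulChar.map_zero, zero_pow (by omega)]
      linear_combination h0
    · intro y hy
      rw [show 2 * k + 2 = 2 * (k + 1) by ring, pow_mul,
        cchi_sq y (Finset.ne_of_mem_erase hy)]; simp
  rw [h3] at h
  have h6 : gsum p ^ (2 * k + 2) = (-1) ^ (k + 1) * (p : ℂ) ^ (k + 1) := by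
    rw [show 2 * k + 2 = 2 * (k + 1) by ring, pow_mul, gsum_sq hp4, neg_pow]
  have : ((Finset.univ.filter
      (fun x : Fin (2 * k + 2) → ZMod p => ∑ i, w i * x i ^ 2 = ρ)).card : ℂ) =
      (p : ℂ) ^ (2 * k + 1) + cchi p (∏ i, w i) * (-1) ^ k * p ^ k := by
    apply mul_left_cancel₀ hp0
    rw [h, h6]
    ring
  simp only [cchi_apply] at this
  exact_mod_cast this
end gaussPart

section fieldPart
variable {p : ℕ} [Fact p.Prime] {F : Type} [Field F] [Fintype F] [Algebra (ZMod p) F]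

lemma exists_obasis (hp : p ≠ 2) (n : ℕ) (hn : Module.finrank (ZMod p) F = n + 1)
    (a : F) (ha : a ≠ 0) (hTr : Algebra.trace (ZMod p) F a⁻¹ ≠ 0) :
    ∃ v : Module.Basis (Fin (n + 1)) (ZMod p) F, v 0 = a⁻¹ ∧
      (∀ i : Fin n, Algebra.trace (ZMod p) F (v i.succ) = 0) ∧
      ∀ i j, i ≠ j → Algebra.trace (ZMod p) F (a * (v i * v j)) = 0 := by
  let H : Submodule (ZMod p) F := LinearMap.ker (Algebra.trace (ZMod p) F)
  have hH : Module.finrank (ZMod p) H = n := by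
    have h := (Algebra.trace (ZMod p) F).finrank_range_add_finrank_ker
    rw [LinearMap.range_eq_top.2 (Algebra.trace_surjective (ZMod p) F), finrank_top,
      Module.finrank_self, hn] at h
    change 1 + Module.finrank (ZMod p) H = n + 1 at h
    omega
  let B : LinearMap.BilinForm (ZMod p) H := LinearMap.mk₂ (ZMod p)
    (fun x y : H => Algebra.trace (ZMod p) F (a * (x * y)))
    (by intros; simp [add_mul, mul_add]) (by intros; simp)
    (by intros; simp [mul_add]) (by intros; simp)
  have hB : LinearMap.IsSymm B := ⟨fun x y => by simp [B, mul_comm (x : F)]⟩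
  have h2 : (2 : ZMod p) ≠ 0 := by
    have : ((2 : ℕ) : ZMod p) ≠ 0 := by
      rw [Ne, ZMod.natCast_eq_zero_iff]
      intro h
      exact hp ((Nat.prime_dvd_prime_iff_eq Fact.out Nat.prime_two).1 h)
    simpa using this
  haveI : Invertible (2 : ZMod p) := invertibleOfNonzero h2
  obtain ⟨b, hb⟩ := LinearMap.BilinForm.exists_orthogonal_basis hB
  have key : ∀ d (_ : d = n) (b : Module.Basis (Fin d) (ZMod p) H) (_ : B.IsOrthoᵢ b),
      ∃ b' : Module.Basis (Fin n) (ZMod p) H, B.IsOrthoᵢ b' := by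
    rintro d rfl b hb; exact ⟨b, hb⟩
  obtain ⟨b, hb⟩ := key _ hH b hb
  have hmem : ∀ x ∈ H, Algebra.trace (ZMod p) F x = 0 := fun x hx => hx
  refine ⟨Module.Basis.mkFinCons a⁻¹ b ?_ ?_, ?_, ?_, ?_⟩
  · intro c x hx h
    have := congrArg (Algebra.trace (ZMod p) F) h
    simp [hmem x hx, hTr] at this
    exact this
  · intro z
    refine ⟨-(Algebra.trace (ZMod p) F z / Algebra.trace (ZMod p) F a⁻¹), ?_⟩
    change Algebra.trace (ZMod p) F _ = 0
    simp [hTr]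
  · simp
  · intro i
    simpa using hmem _ (b i).2
  · intro i j
    have h0 : ∀ i : Fin n, Algebra.trace (ZMod p) F (b i : F) = 0 := fun i => hmem _ (b i).2
    rw [Module.Basis.coe_mkFinCons]
    refine Fin.cases ?_ (fun i => ?_) i <;> refine Fin.cases ?_ (fun j => ?_) j <;> intro hij
    · exact (hij rfl).elim
    · simp [ha, h0]
    · rw [mul_comm (Fin.cons _ _ _)]
      simp [ha, h0]
    · simpa [B] using hb (show i ≠ j from fun h => hij (by rw [h]))

lemma trace_diag {n : ℕ} (a : F) (v : Module.Basis (Fin n) (ZMod p) F)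
    (hv : ∀ i j, i ≠ j → Algebra.trace (ZMod p) F (a * (v i * v j)) = 0)
    (c : Fin n → ZMod p) :
    Algebra.trace (ZMod p) F (a * (v.equivFun.symm c) ^ 2) =
      ∑ i, Algebra.trace (ZMod p) F (a * (v i * v i)) * c i ^ 2 := by
  rw [v.equivFun_symm_apply, sq, Finset.sum_mul_sum, Finset.mul_sum, map_sum]
  refine Finset.sum_congr rfl fun i _ => ?_
  rw [Finset.mul_sum, map_sum, Finset.sum_eq_single i]
  · rw [smul_mul_smul_comm, mul_smul_comm, map_smul, smul_eq_mul]; ring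
  · intro j _ hj
    rw [smul_mul_smul_comm, mul_smul_comm, map_smul, hv i j hj.symm, smul_zero]
  · simp

lemma w_ne {n : ℕ} (a : F) (ha : a ≠ 0) (v : Module.Basis (Fin n) (ZMod p) F)
    (hv : ∀ i j, i ≠ j → Algebra.trace (ZMod p) F (a * (v i * v j)) = 0) (i : Fin n) :
    Algebra.trace (ZMod p) F (a * (v i * v i)) ≠ 0 := by
  intro h
  have h1 : (Algebra.trace (ZMod p) F) ∘ₗ (LinearMap.mulLeft (ZMod p) (a * v i)) = 0 := by
    refine v.ext fun j => ?_
    by_cases hj : i = j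
    · subst hj; simpa [mul_assoc] using h
    · simpa [mul_assoc] using hv i j hj
  obtain ⟨y, hy⟩ := Algebra.trace_surjective (ZMod p) F 1
  have h2 := LinearMap.congr_fun h1 ((a * v i)⁻¹ * y)
  have : a * v i ≠ 0 := mul_ne_zero ha (v.ne_zero i)
  simp only [LinearMap.comp_apply, LinearMap.mulLeft_apply, mul_inv_cancel_left₀ this, hy] at h2
  exact one_ne_zero h2

lemma ringChar_ne (hp : p ≠ 2) : ringChar F ≠ 2 := by
  haveI : CharP F p := charP_of_injective_algebraMap (algebraMap (ZMod p) F).injective p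
  rwa [ringChar.eq F p]

lemma qchar_base [DecidableEq F] (hodd : Odd (Module.finrank (ZMod p) F)) (c : ZMod p) :
    quadraticChar F (algebraMap (ZMod p) F c) = quadraticChar (ZMod p) c := by
  by_cases hc : c = 0
  · simp [hc]
  have hc' : algebraMap (ZMod p) F c ≠ 0 := by simpa using hc
  have key : IsSquare (algebraMap (ZMod p) F c) ↔ IsSquare c := by
    constructor
    · rintro ⟨d, hd⟩
      have h := congrArg (Algebra.norm (ZMod p)) hd
      rw [Algebra.norm_algebraMap, map_mul] at h
      obtain ⟨k, hk⟩ := hodd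
      rw [hk] at h
      refine ⟨Algebra.norm (ZMod p) d / c ^ k, ?_⟩
      field_simp
      linear_combination h
    · rintro ⟨d, rfl⟩
      exact ⟨algebraMap _ _ d, by simp⟩
  by_cases hs : IsSquare c
  · rw [(quadraticChar_one_iff_isSquare hc).2 hs, (quadraticChar_one_iff_isSquare hc').2 (key.2 hs)]
  · rw [quadraticChar_neg_one_iff_not_isSquare.2 hs,
      quadraticChar_neg_one_iff_not_isSquare.2 (fun h => hs (key.1 h))]

lemma qchar_prod [DecidableEq F] {n : ℕ} (hn : Odd n) (a : F) (ha : a ≠ 0)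
    (v : Module.Basis (Fin n) (ZMod p) F)
    (hv : ∀ i j, i ≠ j → Algebra.trace (ZMod p) F (a * (v i * v j)) = 0) :
    quadraticChar (ZMod p) (∏ i, Algebra.trace (ZMod p) F (a * (v i * v i))) =
      quadraticChar F a := by
  classical
  have hfr : Module.finrank (ZMod p) F = n := by simpa using Module.finrank_eq_card_basis v
  have hcard : Fintype.card (Fin n) = Fintype.card Gal(F/ZMod p) := by
    rw [Fintype.card_fin, Fintype.card_eq_nat_card, IsGalois.card_aut_eq_finrank, hfr]
  let e : Fin n ≃ Gal(F/ZMod p) := Fintype.equivOfCardEq hcard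
  let M : Matrix (Fin n) (Fin n) F := Matrix.of fun i s => e s (v i)
  have hM : M * Matrix.diagonal (fun s => e s a) * M.transpose =
      Matrix.diagonal (fun i => algebraMap (ZMod p) F
        (Algebra.trace (ZMod p) F (a * (v i * v i)))) := by
    ext i j
    have h1 : (M * Matrix.diagonal (fun s => e s a) * M.transpose) i j =
        algebraMap (ZMod p) F (Algebra.trace (ZMod p) F (a * (v i * v j))) := by
      rw [trace_eq_sum_automorphisms, Matrix.mul_apply, ← e.sum_comp]
      refine Finset.sum_congr rfl fun s _ => ?_
      simp [M, Matrix.mul_diagonal]; ring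
    rw [h1, Matrix.diagonal_apply]
    split_ifs with h
    · rw [h]
    · rw [hv i j h, map_zero]
  have hdet := congrArg Matrix.det hM
  rw [Matrix.det_mul, Matrix.det_mul, Matrix.det_transpose, Matrix.det_diagonal,
    Matrix.det_diagonal, ← map_prod] at hdet
  have hne : algebraMap (ZMod p) F (∏ i, Algebra.trace (ZMod p) F (a * (v i * v i))) ≠ 0 := by
    simpa [Finset.prod_eq_zero_iff] using fun i => w_ne a ha v hv i
  have hd : M.det ≠ 0 := by
    intro h; rw [h] at hdet; simp only [zero_mul] at hdet; exact hne hdet.symm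
  have hq : ∀ σ : Gal(F/ZMod p), quadraticChar F (σ a) = quadraticChar F a := by
    intro σ
    have hσ : σ a ≠ 0 := by simpa using ha
    have key : IsSquare (σ a) ↔ IsSquare a := by
      constructor
      · rintro ⟨d, hd⟩
        exact ⟨σ.symm d, by rw [← map_mul, ← hd, AlgEquiv.symm_apply_apply]⟩
      · rintro ⟨d, hd⟩
        exact ⟨σ d, by rw [hd, map_mul]⟩
    by_cases hs : IsSquare a
    · rw [(quadraticChar_one_iff_isSquare ha).2 hs,
        (quadraticChar_one_iff_isSquare hσ).2 (key.2 hs)]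
    · rw [quadraticChar_neg_one_iff_not_isSquare.2 hs,
        quadraticChar_neg_one_iff_not_isSquare.2 (fun h => hs (key.1 h))]
  rw [← qchar_base (F := F) (hfr ▸ hn), ← hdet, map_mul, map_mul, map_prod]
  simp only [hq, Finset.prod_const, Finset.card_univ, Fintype.card_fin]
  obtain ⟨k, rfl⟩ := hn
  have h1 := quadraticChar_sq_one hd
  have h2 := quadraticChar_sq_one ha
  rw [pow_succ, pow_mul, h2, one_pow]
  linear_combination (quadraticChar F a) * h1

lemma count_total [DecidableEq F] (hp4 : p % 4 = 3) (k : ℕ) (a : F) (ha : a ≠ 0)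
    (v : Module.Basis (Fin (2 * k + 1)) (ZMod p) F)
    (hv : ∀ i j, i ≠ j → Algebra.trace (ZMod p) F (a * (v i * v j)) = 0)
    (ρ : ZMod p) (hρ : ρ ≠ 0) :
    ((Finset.univ.filter (fun x : F => Algebra.trace (ZMod p) F (a * x ^ 2) = ρ)).card : ℤ) =
      (p : ℤ) ^ (2 * k) + quadraticChar F a * quadraticChar (ZMod p) ρ * (-1) ^ k * p ^ k := by
  rw [← qchar_prod ⟨k, rfl⟩ a ha v hv, ← count_odd hp4 k _ (w_ne a ha v hv) ρ hρ]
  congr 1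
  symm
  refine Finset.card_bij (fun c _ => v.equivFun.symm c) ?_ ?_ ?_
  · intro c hc
    simpa [trace_diag a v hv, -Module.Basis.equivFun_symm_apply] using hc
  · intro c _ d _ h
    exact v.equivFun.symm.injective h
  · intro x hx
    refine ⟨v.equivFun x, ?_, v.equivFun.symm_apply_apply x⟩
    have h := trace_diag a v hv (v.equivFun x)
    rw [v.equivFun.symm_apply_apply] at h
    simp only [Finset.mem_filter, Finset.mem_univ, true_and] at hx ⊢
    rw [← h, hx]

lemma count_hyper [DecidableEq F] (hp4 : p % 4 = 3) (k : ℕ) (a : F) (ha : a ≠ 0)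
    (hTr : Algebra.trace (ZMod p) F a⁻¹ ≠ 0)
    (v : Module.Basis (Fin (2 * k + 2 + 1)) (ZMod p) F) (hv0 : v 0 = a⁻¹)
    (hvs : ∀ i : Fin (2 * k + 2), Algebra.trace (ZMod p) F (v i.succ) = 0)
    (hv : ∀ i j, i ≠ j → Algebra.trace (ZMod p) F (a * (v i * v j)) = 0)
    (ρ : ZMod p) (hρ : ρ ≠ 0) :
    ((Finset.univ.filter (fun x : F => Algebra.trace (ZMod p) F (a * x ^ 2) = ρ ∧
        Algebra.trace (ZMod p) F x = 0)).card : ℤ) =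
      (p : ℤ) ^ (2 * k + 1) + quadraticChar F a *
        quadraticChar (ZMod p) (Algebra.trace (ZMod p) F a⁻¹) * (-1) ^ k * p ^ k := by
  have hprod := qchar_prod ⟨k + 1, by ring⟩ a ha v hv
  rw [Fin.prod_univ_succ, hv0, mul_inv_cancel_left₀ ha, map_mul] at hprod
  have hsq := quadraticChar_sq_one hTr
  have hE := count_even hp4 k (fun i : Fin (2 * k + 2) =>
    Algebra.trace (ZMod p) F (a * (v i.succ * v i.succ))) (fun i => w_ne a ha v hv i.succ) ρ hρ
  have htr : ∀ c : Fin (2 * k + 2 + 1) → ZMod p,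
      Algebra.trace (ZMod p) F (v.equivFun.symm c) = c 0 * Algebra.trace (ZMod p) F a⁻¹ := by
    intro c
    rw [v.equivFun_symm_apply, map_sum, Fin.sum_univ_succ]
    simp [hvs, hv0]
  have hcard : (Finset.univ.filter (fun x : F => Algebra.trace (ZMod p) F (a * x ^ 2) = ρ ∧
        Algebra.trace (ZMod p) F x = 0)).card =
      (Finset.univ.filter (fun x : Fin (2 * k + 2) → ZMod p => ∑ i,
        Algebra.trace (ZMod p) F (a * (v i.succ * v i.succ)) * x i ^ 2 = ρ)).card := by
    symm
    refine Finset.card_bij (fun c _ => v.equivFun.symm (Fin.cons 0 c)) ?_ ?_ ?_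
    · intro c hc
      simp only [Finset.mem_filter, Finset.mem_univ, true_and] at hc ⊢
      rw [trace_diag a v hv, htr, Fin.sum_univ_succ]
      simp [hc]
    · intro c _ d _ h
      exact Fin.cons_injective2.right _ (v.equivFun.symm.injective h)
    · intro x hx
      simp only [Finset.mem_filter, Finset.mem_univ, true_and] at hx
      obtain ⟨c, rfl⟩ := v.equivFun.symm.surjective x
      rw [htr, trace_diag a v hv] at hx
      have h0 : c 0 = 0 := by simpa [hTr] using hx.2
      refine ⟨Fin.tail c, ?_, ?_⟩
      · have h1 := hx.1
        rw [Fin.sum_univ_succ, h0] at h1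
        simpa [Fin.tail] using h1
      · rw [← h0, Fin.cons_self_tail]
  rw [hcard, hE, ← hprod]
  linear_combination (-(quadraticChar (ZMod p)
    (∏ i : Fin (2 * k + 2), Algebra.trace (ZMod p) F (a * (v i.succ * v i.succ)))
    * (-1) ^ k * (p : ℤ) ^ k)) * hsq

end fieldPart

/-- `p ≡ 3 (mod 4)`, `m ≥ 3` odd, `a ∈ F_r^*` with `Tr(a⁻¹) ≠ 0`,
`ρ ∈ F_p^*`.  Then
`N(ρ) = N_1(ρ) = (p-1)p^{m-2}/2 + (1/2) η(a) (-1)^{(m-1)/2} p^{(m-3)/2} (p η̄(ρ) + η̄(Tr(a⁻¹)))`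
(stated with both sides multiplied by 2). -/
theorem stmt_19 (p m : ℕ) [Fact p.Prime] (hp4 : p % 4 = 3) (hm : 3 ≤ m) (hmo : Odd m)
    (F : Type) [Field F] [Fintype F] [DecidableEq F] [Algebra (ZMod p) F]
    (hcard : Fintype.card F = p ^ m)
    (a : F) (ha : a ≠ 0) (hTr : Algebra.trace (ZMod p) F a⁻¹ ≠ 0)
    (ρ : ZMod p) (hρ : ρ ≠ 0) :
    Nsq' p F a ρ = Nnsq p F a ρ ∧
    2 * (Nsq' p F a ρ : ℤ) = (p - 1) * p ^ (m - 2)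
      + quadraticChar F a * (-1) ^ ((m - 1) / 2) * p ^ ((m - 3) / 2)
        * (p * quadraticChar (ZMod p) ρ
          + quadraticChar (ZMod p) (Algebra.trace (ZMod p) F a⁻¹)) := by
  classical
  have hp : p ≠ 2 := by omega
  have hneg : ¬ IsSquare (-1 : ZMod p) := by
    rw [FiniteField.isSquare_neg_one_iff]; simpa using hp4
  have hnegsq : ∀ t : ZMod p, t ≠ 0 → (IsSquare (-t) ↔ ¬ IsSquare t) := by
    intro t ht
    have h1 : quadraticChar (ZMod p) (-t) = - quadraticChar (ZMod p) t := by
      rw [neg_eq_neg_one_mul, map_mul, quadraticChar_neg_one_iff_not_isSquare.2 hneg]; ring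
    rw [← quadraticChar_one_iff_isSquare (neg_ne_zero.2 ht),
      ← quadraticChar_neg_one_iff_not_isSquare, h1]
    omega
  have hEq : Nsq' p F a ρ = Nnsq p F a ρ := by
    unfold Nsq' Nnsq
    refine Set.ncard_congr (fun x _ => -x) ?_ ?_ ?_
    · rintro x ⟨⟨h1, h2⟩, h3⟩
      refine ⟨?_, by simpa using h3⟩
      rw [map_neg, hnegsq _ h2]; exact fun h => h h1
    · intro x y _ _ h; exact neg_injective h
    · rintro x ⟨h1, h2⟩
      have h0 : Algebra.trace (ZMod p) F x ≠ 0 := fun h => h1 (by rw [h]; exact ⟨0, by simp⟩)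
      refine ⟨-x, ⟨⟨?_, ?_⟩, by simpa using h2⟩, neg_neg x⟩
      · rw [map_neg]; exact (hnegsq _ h0).2 h1
      · rw [map_neg]; exact neg_ne_zero.2 h0
  refine ⟨hEq, ?_⟩
  obtain ⟨k, rfl⟩ : ∃ k, m = 2 * k + 2 + 1 := by
    obtain ⟨j, hj⟩ := hmo; exact ⟨j - 1, by omega⟩
  have hfr : Module.finrank (ZMod p) F = 2 * k + 2 + 1 := by
    have h := Module.card_eq_pow_finrank (K := ZMod p) (V := F)
    rw [hcard, ZMod.card] at h
    exact (Nat.pow_right_injective (Fact.out : p.Prime).two_le h).symm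
  obtain ⟨v, hv0, hvs, hv⟩ := exists_obasis hp _ hfr a ha hTr
  have hT := count_total hp4 (k + 1) a ha v hv ρ hρ
  have hH := count_hyper hp4 k a ha hTr v hv0 hvs hv ρ hρ
  have hsplit : Nsq' p F a ρ + Nnsq p F a ρ +
      (Finset.univ.filter (fun x : F => Algebra.trace (ZMod p) F (a * x ^ 2) = ρ ∧
        Algebra.trace (ZMod p) F x = 0)).card =
      (Finset.univ.filter (fun x : F => Algebra.trace (ZMod p) F (a * x ^ 2) = ρ)).card := by
    have e1 : Nsq' p F a ρ = (Finset.univ.filter (fun x : F =>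
        (IsSquare (Algebra.trace (ZMod p) F x) ∧ Algebra.trace (ZMod p) F x ≠ 0) ∧
          Algebra.trace (ZMod p) F (a * x ^ 2) = ρ)).card := by
      rw [Nsq', ← Set.ncard_coe_finset]; congr 1; ext; simp
    have e2 : Nnsq p F a ρ = (Finset.univ.filter (fun x : F =>
        ¬ IsSquare (Algebra.trace (ZMod p) F x) ∧
          Algebra.trace (ZMod p) F (a * x ^ 2) = ρ)).card := by
      rw [Nnsq, ← Set.ncard_coe_finset]; congr 1; ext; simp
    rw [e1, e2, Finset.card_filter, Finset.card_filter, Finset.card_filter, Finset.card_filter,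
      ← Finset.sum_add_distrib, ← Finset.sum_add_distrib]
    refine Finset.sum_congr rfl fun x _ => ?_
    by_cases h0 : Algebra.trace (ZMod p) F x = 0
    · simp [h0]
    · by_cases hs : IsSquare (Algebra.trace (ZMod p) F x) <;> simp [h0, hs]
  rw [← hEq] at hsplit
  have hs' := congrArg (Nat.cast : ℕ → ℤ) hsplit
  rw [Nat.cast_add, Nat.cast_add, hT, hH] at hs'
  rw [show 2 * k + 2 + 1 - 2 = 2 * k + 1 by omega,
    show (2 * k + 2 + 1 - 1) / 2 = k + 1 by omega, show (2 * k + 2 + 1 - 3) / 2 = k by omega]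
  linear_combination hs'
end
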